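/- Let Ω be a C^{1,1}-domain, i.e. there is u > 0 such that the two-sided ball condition with radius u holds at every point of Γ. Let δ ≥ 0 with δ ≠ 1. Then for all sufficiently small r > 0 there exists a > 0 such that the boundary Hardy inequality with constant a holds on Γ_r, and the boundary Hardy constant satisfies a_δ(Γ) = 2/|δ−1|. -/

import Mathlib

open MeasureTheory Metric Set ENNReal RealInnerProductSpace

noncomputable section

/-- The Euclidean distance from `x` to the boundary `Γ = ∂Ω` of `Ω`. -/
def distB {d : ℕ} (Ω : Set (EuclideanSpace ℝ (Fin d))) (x : EuclideanSpace ℝ (Fin d)) : ℝ :=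
  Metric.infDist x (frontier Ω)

/-- The boundary layer `Γ_r = {x ∈ Ω : d_Γ(x) < r}`. -/
def bdryLayer {d : ℕ} (Ω : Set (EuclideanSpace ℝ (Fin d))) (r : ℝ) :
    Set (EuclideanSpace ℝ (Fin d)) :=
  {x | x ∈ Ω ∧ distB Ω x < r}

/-- `C_c^1` real functions with compact support contained in `U`. -/
def IsCc1 {d : ℕ} (U : Set (EuclideanSpace ℝ (Fin d)))
    (ψ : EuclideanSpace ℝ (Fin d) → ℝ) : Prop :=
  ContDiff ℝ 1 ψ ∧ HasCompactSupport ψ ∧ tsupport ψ ⊆ U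

/-- The `L²` norm with respect to Lebesgue measure. -/
def L2N {d : ℕ} (f : EuclideanSpace ℝ (Fin d) → ℝ) : ℝ≥0∞ :=
  eLpNorm f 2 volume

/-- The weighted norm `‖d_Γ^p ψ‖₂`. -/
def wNorm {d : ℕ} (Ω : Set (EuclideanSpace ℝ (Fin d))) (p : ℝ)
    (ψ : EuclideanSpace ℝ (Fin d) → ℝ) : ℝ≥0∞ :=
  L2N (fun x => distB Ω x ^ p * ψ x)

/-- The weighted gradient norm `‖d_Γ^p |∇ψ|‖₂`. -/
def wGradNorm {d : ℕ} (Ω : Set (EuclideanSpace ℝ (Fin d))) (p : ℝ)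
    (ψ : EuclideanSpace ℝ (Fin d) → ℝ) : ℝ≥0∞ :=
  L2N (fun x => distB Ω x ^ p * ‖fderiv ℝ ψ x‖)

/-- The (boundary) Hardy inequality `‖d_Γ^{δ/2-1}ψ‖₂ ≤ a ‖d_Γ^{δ/2}|∇ψ|‖₂`
with constant `a` for all test functions `ψ ∈ C_c^1(S)`. -/
def BHardy {d : ℕ} (Ω : Set (EuclideanSpace ℝ (Fin d))) (δ : ℝ)
    (S : Set (EuclideanSpace ℝ (Fin d))) (a : ℝ) : Prop :=
  ∀ ψ, IsCc1 S ψ → wNorm Ω (δ/2 - 1) ψ ≤ ENNReal.ofReal a * wGradNorm Ω (δ/2) ψ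

/-- The weak Hardy inequality `‖d_Γ^{δ/2-1}ψ‖₂ ≤ b ‖d_Γ^{δ/2}|∇ψ|‖₂ + c ‖ψ‖₂`
with constants `b, c` for all test functions `ψ ∈ C_c^1(S)`. -/
def WHardy {d : ℕ} (Ω : Set (EuclideanSpace ℝ (Fin d))) (δ : ℝ)
    (S : Set (EuclideanSpace ℝ (Fin d))) (b c : ℝ) : Prop :=
  ∀ ψ, IsCc1 S ψ →
    wNorm Ω (δ/2 - 1) ψ ≤ ENNReal.ofReal b * wGradNorm Ω (δ/2) ψ + ENNReal.ofReal c * L2N ψ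

/-- The optimal Hardy constant for test functions supported in `S`
(the infimum of the `a > 0` for which the Hardy inequality holds on `S`;
`∞` if there is no such constant). -/
def hardyConstS {d : ℕ} (Ω : Set (EuclideanSpace ℝ (Fin d))) (δ : ℝ)
    (S : Set (EuclideanSpace ℝ (Fin d))) : ℝ≥0∞ :=
  sInf {t | ∃ a : ℝ, 0 < a ∧ t = ENNReal.ofReal a ∧ BHardy Ω δ S a}

/-- The boundary Hardy constant `a_δ(Γ) = inf_{r>0} a_δ(Γ_r)`. -/
def hardyConst {d : ℕ} (Ω : Set (EuclideanSpace ℝ (Fin d))) (δ : ℝ) : ℝ≥0∞ :=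
  ⨅ (r : ℝ) (_ : 0 < r), hardyConstS Ω δ (bdryLayer Ω r)

/-- The local boundary Hardy constant `a_δ(Γ ∩ U) = inf_{r>0} a_δ(Γ_r ∩ U)`. -/
def hardyConstOn {d : ℕ} (Ω : Set (EuclideanSpace ℝ (Fin d))) (δ : ℝ)
    (U : Set (EuclideanSpace ℝ (Fin d))) : ℝ≥0∞ :=
  ⨅ (r : ℝ) (_ : 0 < r), hardyConstS Ω δ (bdryLayer Ω r ∩ U)

/-- The weak Hardy constant `b_δ(Ω)`: the infimum of the `b > 0` for which there
is a `c > 0` such that the weak Hardy inequality holds on `Ω`. -/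
def weakConstDomain {d : ℕ} (Ω : Set (EuclideanSpace ℝ (Fin d))) (δ : ℝ) : ℝ≥0∞ :=
  sInf {t | ∃ b c : ℝ, 0 < b ∧ 0 < c ∧ t = ENNReal.ofReal b ∧ WHardy Ω δ Ω b c}

/-- The weak Hardy constant `b_δ(Γ)`: the infimum of the `b > 0` for which there
are `r > 0` and `c > 0` such that the weak Hardy inequality holds on `Γ_r`. -/
def weakConstBdry {d : ℕ} (Ω : Set (EuclideanSpace ℝ (Fin d))) (δ : ℝ) : ℝ≥0∞ :=
  sInf {t | ∃ b c r : ℝ, 0 < b ∧ 0 < c ∧ 0 < r ∧ t = ENNReal.ofReal b ∧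
    WHardy Ω δ (bdryLayer Ω r) b c}

/-- The weak Hardy constant `b_δ(Γ ∩ U)`. -/
def weakConstOn {d : ℕ} (Ω : Set (EuclideanSpace ℝ (Fin d))) (δ : ℝ)
    (U : Set (EuclideanSpace ℝ (Fin d))) : ℝ≥0∞ :=
  sInf {t | ∃ b c r : ℝ, 0 < b ∧ 0 < c ∧ 0 < r ∧ t = ENNReal.ofReal b ∧
    WHardy Ω δ (bdryLayer Ω r ∩ U) b c}

/-- A domain: a nonempty open connected proper subset of `ℝ^d`. -/
def IsDomainSet {d : ℕ} (Ω : Set (EuclideanSpace ℝ (Fin d))) : Prop :=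
  IsOpen Ω ∧ IsConnected Ω ∧ Ω ≠ Set.univ

/-- The two-sided (interior and exterior) ball condition with radius `u` at `y ∈ Γ`:
there is an interior ball `B̄(z;u) ⊆ Ω ∪ {y}` touching `Γ` exactly at `y`, and an
exterior ball touching `Ω̄` exactly at `y`. -/
def TwoSidedBall {d : ℕ} (Ω : Set (EuclideanSpace ℝ (Fin d))) (u : ℝ)
    (y : EuclideanSpace ℝ (Fin d)) : Prop :=
  (∃ z ∈ Ω, Metric.closedBall z u ∩ Ωᶜ = {y}) ∧
  (∃ z' ∈ (closure Ω)ᶜ, Metric.closedBall z' u ∩ closure Ω = {y})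

section Geometry

variable {d : ℕ} {Ω : Set (EuclideanSpace ℝ (Fin d))}

theorem distB_nonneg (Ω : Set (EuclideanSpace ℝ (Fin d))) (x : EuclideanSpace ℝ (Fin d)) :
    0 ≤ distB Ω x :=
  Metric.infDist_nonneg

theorem lipschitzWith_distB (Ω : Set (EuclideanSpace ℝ (Fin d))) : LipschitzWith 1 (distB Ω) :=
  Metric.lipschitz_infDist_pt _

theorem continuous_distB (Ω : Set (EuclideanSpace ℝ (Fin d))) : Continuous (distB Ω) :=
  (lipschitzWith_distB Ω).continuous

theorem IsDomainSet.frontier_nonempty (hΩ : IsDomainSet Ω) : (frontier Ω).Nonempty :=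
  nonempty_frontier_iff.2 ⟨hΩ.2.1.nonempty, hΩ.2.2⟩

theorem IsDomainSet.distB_pos (hΩ : IsDomainSet Ω) {x : EuclideanSpace ℝ (Fin d)} (hx : x ∈ Ω) :
    0 < distB Ω x := by
  refine (isClosed_frontier.notMem_iff_infDist_pos hΩ.frontier_nonempty).1 fun h => ?_
  rw [hΩ.1.frontier_eq] at h
  exact h.2 hx

theorem distB_le_norm_sub_of_notMem {x q : EuclideanSpace ℝ (Fin d)} (hx : x ∈ Ω) (hq : q ∉ Ω) :
    distB Ω x ≤ ‖x - q‖ := by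
  obtain ⟨y, hy, hxy⟩ := exists_mem_frontier_infDist_compl_eq_dist hx
    ((Set.ne_univ_iff_exists_notMem Ω).2 ⟨q, hq⟩)
  calc distB Ω x ≤ dist x y := Metric.infDist_le_dist_of_mem hy
    _ = infDist x Ωᶜ := hxy.symm
    _ ≤ dist x q := Metric.infDist_le_dist_of_mem hq
    _ = ‖x - q‖ := dist_eq_norm _ _

theorem mem_of_norm_sub_lt_distB {x q : EuclideanSpace ℝ (Fin d)} (hx : x ∈ Ω)
    (hq : ‖x - q‖ < distB Ω x) : q ∈ Ω := by
  by_contra h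
  exact absurd (distB_le_norm_sub_of_notMem hx h) (not_le.2 hq)

/-- The touching balls at `y`, recorded through the vector `w` from `y` to the centre of the
interior ball, bound the distance to the boundary from both sides. -/
structure TouchingBalls (Ω : Set (EuclideanSpace ℝ (Fin d))) (u : ℝ)
    (y w : EuclideanSpace ℝ (Fin d)) : Prop where
  norm_eq : ‖w‖ = u
  le_distB : ∀ x, u - ‖x - (y + w)‖ ≤ distB Ω x
  distB_le : ∀ x ∈ Ω, distB Ω x ≤ ‖x - (y - w)‖ - u
  ball_subset : ball (y + w) u ⊆ Ω

theorem norm_lineMap_sub_lt {y z : EuclideanSpace ℝ (Fin d)} {u s : ℝ} (hzu : ‖y - z‖ ≤ u)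
    (hu : 0 < u) (hs : s ∈ Set.Ioc (0 : ℝ) 1) : ‖y + s • (z - y) - z‖ < u := by
  have h : y + s • (z - y) - z = (1 - s) • (y - z) := by module
  rw [h, norm_smul, Real.norm_of_nonneg (by linarith [hs.2])]
  nlinarith [norm_nonneg (y - z), hs.1, hs.2]

theorem TwoSidedBall.exists_touchingBalls (hΩ : IsDomainSet Ω) {u : ℝ} (hu : 0 < u)
    {y : EuclideanSpace ℝ (Fin d)} (hy : y ∈ frontier Ω) (h : TwoSidedBall Ω u y) :
    ∃ w, TouchingBalls Ω u y w := by
  obtain ⟨⟨z, hz, hzb⟩, z', hz', hzb'⟩ := h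
  have hyΩ : y ∉ Ω := fun h => by rw [hΩ.1.frontier_eq] at hy; exact hy.2 h
  have hycl : y ∈ closure Ω := frontier_subset_closure hy
  have hyz : ‖y - z‖ ≤ u := by
    have : y ∈ closedBall z u ∩ Ωᶜ := by rw [hzb]; rfl
    simpa [dist_eq_norm] using this.1
  have hyz' : ‖y - z'‖ ≤ u := by
    have : y ∈ closedBall z' u ∩ closure Ω := by rw [hzb']; rfl
    simpa [dist_eq_norm] using this.1
  have hin : ∀ x, ‖x - z‖ ≤ u → x ≠ y → x ∈ Ω := fun x hx hxy => by
    by_contra hxΩ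
    have : x ∈ closedBall z u ∩ Ωᶜ := ⟨by simpa [dist_eq_norm] using hx, hxΩ⟩
    rw [hzb] at this
    exact hxy this
  have hout : ∀ x, ‖x - z'‖ ≤ u → x ∈ closure Ω → x = y := fun x hx hxΩ => by
    have : x ∈ closedBall z' u ∩ closure Ω := ⟨by simpa [dist_eq_norm] using hx, hxΩ⟩
    rwa [hzb'] at this
  have hyz'ne : z' ≠ y := fun h => hz' (h ▸ hycl)
  have hyz_eq : ‖y - z‖ = u := by
    refine le_antisymm hyz (le_of_not_gt fun hlt => ?_)
    have hcont : Filter.Tendsto (fun s : ℝ => ‖y + s • (z' - y) - z‖) (nhdsWithin 0 (Ioi 0))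
        (nhds ‖y - z‖) := by
      have : Continuous (fun s : ℝ => ‖y + s • (z' - y) - z‖) := by fun_prop
      simpa using (this.tendsto 0).mono_left nhdsWithin_le_nhds
    obtain ⟨s, hs1, hs2⟩ := ((hcont.eventually_lt_const hlt).and
      (Ioc_mem_nhdsGT (zero_lt_one' ℝ))).exists
    have hne : y + s • (z' - y) ≠ y := by
      simp [sub_eq_zero, hyz'ne, hs2.1.ne']
    exact hne (hout _ (norm_lineMap_sub_lt hyz' hu hs2).le (subset_closure (hin _ hs1.le hne)))
  have hyz'_eq : ‖y - z'‖ = u := by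
    refine le_antisymm hyz' (le_of_not_gt fun hlt => ?_)
    have hopen : IsOpen (ball z' u) := isOpen_ball
    obtain ⟨x, hx, hxΩ⟩ := mem_closure_iff.1 hycl (ball z' u) hopen
      (by simpa [dist_eq_norm] using hlt)
    have := hout x (by simpa [dist_eq_norm] using (mem_ball.1 hx).le) (subset_closure hxΩ)
    exact hyΩ (this ▸ hxΩ)
  have hzz' : 2 * u ≤ ‖z - z'‖ := by
    by_contra! hlt
    have e1 : (1 / 2 : ℝ) • (z + z') - z = (-(1 / 2 : ℝ)) • (z - z') := by module
    have e2 : (1 / 2 : ℝ) • (z + z') - z' = (1 / 2 : ℝ) • (z - z') := by module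
    have h1 : ‖(1 / 2 : ℝ) • (z + z') - z‖ < u := by
      rw [e1, norm_smul]; norm_num; linarith
    have h2 : ‖(1 / 2 : ℝ) • (z + z') - z'‖ < u := by
      rw [e2, norm_smul]; norm_num; linarith
    have hne : (1 / 2 : ℝ) • (z + z') ≠ y := fun h => by rw [h] at h1; linarith
    exact hne (hout _ h2.le (subset_closure (hin _ h1.le hne)))
  have hmid : z' = y - (z - y) := by
    have hp := parallelogram_law_with_norm ℝ (y - z) (y - z')
    have e : (y - z) - (y - z') = -(z - z') := by abel
    rw [e, norm_neg, hyz_eq, hyz'_eq] at hp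
    have : ‖(y - z) + (y - z')‖ = 0 := by
      have := norm_nonneg ((y - z) + (y - z'))
      nlinarith
    have := norm_eq_zero.1 this
    rw [← sub_eq_zero, ← neg_eq_zero, ← this]
    abel
  have hz0 : y + (z - y) = z := by abel
  refine ⟨z - y, by rw [norm_sub_rev, hyz_eq], fun x => ?_, fun x hx => ?_, ?_⟩
  · rw [hz0]
    obtain ⟨q, hq, hxq⟩ := isClosed_frontier.exists_infDist_eq_dist hΩ.frontier_nonempty x
    have hqz : u ≤ ‖q - z‖ := by
      by_contra! hlt
      have hne : q ≠ y := fun h => by rw [h] at hlt; linarith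
      rw [hΩ.1.frontier_eq] at hq
      exact hq.2 (hin q hlt.le hne)
    have : distB Ω x = ‖q - x‖ := by rw [distB, hxq, dist_comm, dist_eq_norm]
    rw [this]
    linarith [norm_sub_le_norm_sub_add_norm_sub q x z]
  · rw [← hmid]
    have hxz' : u < ‖x - z'‖ := by
      by_contra! hle
      exact hyΩ (hout x hle (subset_closure hx) ▸ hx)
    have h0 : 0 < ‖x - z'‖ := hu.trans hxz'
    have e1 : z' + (u / ‖x - z'‖) • (x - z') - z' = (u / ‖x - z'‖) • (x - z') := by abel
    have hq : z' + (u / ‖x - z'‖) • (x - z') ∉ Ω := fun hq => by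
      have := hout _ (le_of_eq (by
        rw [e1, norm_smul, Real.norm_of_nonneg (by positivity)]; field_simp)) (subset_closure hq)
      exact hyΩ (this ▸ hq)
    refine (distB_le_norm_sub_of_notMem hx hq).trans_eq ?_
    have e2 : x - (z' + (u / ‖x - z'‖) • (x - z')) = (1 - u / ‖x - z'‖) • (x - z') := by module
    have hle : u / ‖x - z'‖ ≤ 1 := by rw [div_le_one h0]; exact hxz'.le
    rw [e2, norm_smul, Real.norm_of_nonneg (by linarith)]
    field_simp
  · rw [hz0]
    intro x hx
    rw [mem_ball, dist_eq_norm] at hx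
    exact hin x hx.le fun h => by rw [h] at hx; linarith

/-- A point at distance less than `u` from the boundary lies on the axis of the touching balls
at its nearest boundary point. -/
theorem exists_touchingBalls_of_distB_le (hΩ : IsDomainSet Ω) {u : ℝ} (hu : 0 < u)
    (hball : ∀ y ∈ frontier Ω, TwoSidedBall Ω u y) {x : EuclideanSpace ℝ (Fin d)} (hx : x ∈ Ω)
    (hxu : distB Ω x ≤ u) :
    ∃ y w, TouchingBalls Ω u y w ∧ ‖x - (y - w)‖ = u + distB Ω x ∧
      ‖x - (y + w)‖ = u - distB Ω x := by
  obtain ⟨y, hy, hxy⟩ := isClosed_frontier.exists_infDist_eq_dist hΩ.frontier_nonempty x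
  obtain ⟨w, hw⟩ := (hball y hy).exists_touchingBalls hΩ hu hy
  have hd : distB Ω x = ‖x - y‖ := by rw [distB, hxy, dist_eq_norm]
  have e1 : x - (y - w) = (x - y) + w := by abel
  have e2 : x - (y + w) = (x - y) - w := by abel
  have h1 : ‖x - (y - w)‖ = u + distB Ω x := by
    refine le_antisymm ?_ (by linarith [hw.distB_le x hx])
    rw [e1, hd]
    linarith [norm_add_le (x - y) w, hw.norm_eq]
  refine ⟨y, w, hw, h1, ?_⟩
  have hp := parallelogram_law_with_norm ℝ (x - y) w
  rw [← e1, ← e2, h1, ← hd, hw.norm_eq] at hp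
  refine (pow_left_inj₀ (norm_nonneg _) (by linarith) two_ne_zero).1 ?_
  nlinarith

theorem norm_add_add_norm_sub_le {p v : EuclideanSpace ℝ (Fin d)} (hp : p ≠ 0) :
    ‖p + v‖ + ‖p - v‖ ≤ 2 * ‖p‖ + ‖v‖ ^ 2 / ‖p‖ := by
  have hp0 : 0 < ‖p‖ := norm_pos_iff.2 hp
  have h := parallelogram_law_with_norm ℝ p v
  rw [← sub_nonneg]
  have : 2 * ‖p‖ + ‖v‖ ^ 2 / ‖p‖ - (‖p + v‖ + ‖p - v‖)
      = ((‖p + v‖ - ‖p‖) ^ 2 + (‖p - v‖ - ‖p‖) ^ 2) / (2 * ‖p‖) := by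
    field_simp
    nlinarith
  rw [this]
  positivity

/-- Second differences of the distance to the boundary are uniformly bounded. -/
theorem abs_second_difference_distB_le (hΩ : IsDomainSet Ω) {u : ℝ} (hu : 0 < u)
    (hball : ∀ y ∈ frontier Ω, TwoSidedBall Ω u y) {x v : EuclideanSpace ℝ (Fin d)} (hx : x ∈ Ω)
    (hxu : distB Ω x ≤ u / 2) (hv : ‖v‖ < distB Ω x) :
    |distB Ω (x + v) + distB Ω (x - v) - 2 * distB Ω x| ≤ 2 / u * ‖v‖ ^ 2 := by
  obtain ⟨y, w, hw, h1, h2⟩ := exists_touchingBalls_of_distB_le hΩ hu hball hx (by linarith)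
  have hpos := hΩ.distB_pos hx
  have hxp : x + v ∈ Ω := mem_of_norm_sub_lt_distB hx (by simpa using hv)
  have hxm : x - v ∈ Ω := mem_of_norm_sub_lt_distB hx (by simpa using hv)
  have hp : x - (y - w) ≠ 0 := norm_pos_iff.1 (by linarith)
  have hq : x - (y + w) ≠ 0 := norm_pos_iff.1 (by linarith)
  have hp1 := norm_add_add_norm_sub_le (v := v) hp
  have hq1 := norm_add_add_norm_sub_le (v := v) hq
  have e1 : x + v - (y - w) = x - (y - w) + v := by abel
  have e2 : x - v - (y - w) = x - (y - w) - v := by abel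
  have e3 : x + v - (y + w) = x - (y + w) + v := by abel
  have e4 : x - v - (y + w) = x - (y + w) - v := by abel
  have b1 := hw.distB_le _ hxp
  have b2 := hw.distB_le _ hxm
  have b3 := hw.le_distB (x + v)
  have b4 := hw.le_distB (x - v)
  rw [e1] at b1
  rw [e2] at b2
  rw [e3] at b3
  rw [e4] at b4
  have c1 : ‖v‖ ^ 2 / ‖x - (y - w)‖ ≤ 2 / u * ‖v‖ ^ 2 := by
    rw [h1, div_mul_eq_mul_div, div_le_div_iff₀ (by linarith) hu]
    nlinarith [sq_nonneg ‖v‖]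
  have c2 : ‖v‖ ^ 2 / ‖x - (y + w)‖ ≤ 2 / u * ‖v‖ ^ 2 := by
    rw [h2, div_mul_eq_mul_div, div_le_div_iff₀ (by linarith) hu]
    nlinarith [sq_nonneg ‖v‖]
  rw [abs_le]
  constructor <;> linarith

theorem hasFDerivAt_of_le_of_le {F : Type*} [NormedAddCommGroup F] [NormedSpace ℝ F]
    {f g h : F → ℝ} {f' h' : F →L[ℝ] ℝ} {x : F} (hf : HasFDerivAt f f' x)
    (hh : HasFDerivAt h h' x) (hfg : ∀ᶠ y in nhds x, f y ≤ g y) (hgh : ∀ᶠ y in nhds x, g y ≤ h y)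
    (hfx : f x = g x) (hhx : h x = g x) : HasFDerivAt g f' x := by
  have heq : h' - f' = 0 := by
    have hmin : IsLocalMin (fun y => h y - f y) x := by
      filter_upwards [hfg, hgh] with y h1 h2
      linarith
    exact hmin.hasFDerivAt_eq_zero (hh.sub hf)
  have hh0 : HasFDerivAt (fun y => h y - f y) (0 : F →L[ℝ] ℝ) x := heq ▸ hh.sub hf
  have hg0 : HasFDerivAt (fun y => g y - f y) (0 : F →L[ℝ] ℝ) x := by
    rw [hasFDerivAt_iff_isLittleO] at hh0 ⊢
    refine (Asymptotics.IsBigO.of_bound 1 ?_).trans_isLittleO hh0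
    filter_upwards [hfg, hgh] with y h1 h2
    simp only [hfx, hhx, sub_self, sub_zero, zero_apply, Real.norm_eq_abs]
    rw [abs_of_nonneg (by linarith), abs_of_nonneg (by linarith)]
    linarith
  rw [← zero_add f']
  exact (hg0.add hf).congr_of_eventuallyEq (Filter.Eventually.of_forall fun y => by simp)

theorem exists_hasFDerivAt_distB (hΩ : IsDomainSet Ω) {u : ℝ} (hu : 0 < u)
    (hball : ∀ y ∈ frontier Ω, TwoSidedBall Ω u y) {x : EuclideanSpace ℝ (Fin d)} (hx : x ∈ Ω)
    (hxu : distB Ω x < u) :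
    ∃ n : EuclideanSpace ℝ (Fin d), ‖n‖ = 1 ∧ HasFDerivAt (distB Ω) (innerSL ℝ n) x := by
  obtain ⟨y, w, hw, h1, h2⟩ := exists_touchingBalls_of_distB_le hΩ hu hball hx hxu.le
  have hpos := hΩ.distB_pos hx
  have hp : x - (y - w) ≠ 0 := norm_pos_iff.1 (by linarith)
  have hq : x - (y + w) ≠ 0 := norm_pos_iff.1 (by linarith)
  have key : ∀ c : EuclideanSpace ℝ (Fin d), x - c ≠ 0 →
      HasFDerivAt (fun x' => ‖x' - c‖) (innerSL ℝ (‖x - c‖⁻¹ • (x - c))) x := by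
    intro c hc
    have h := ((hasFDerivAt_id x).sub_const c).norm_sq.sqrt (by positivity)
    simp only [id, Real.sqrt_sq (norm_nonneg _)] at h
    refine h.congr_fderiv ?_
    ext v
    simp
    ring
  refine ⟨-(‖x - (y + w)‖⁻¹ • (x - (y + w))), by rw [norm_neg]; exact norm_smul_inv_norm (𝕜 := ℝ) hq, ?_⟩
  refine hasFDerivAt_of_le_of_le (f := fun x' => u - ‖x' - (y + w)‖)
    (h := fun x' => ‖x' - (y - w)‖ - u) ?_ ((key _ hp).sub_const u)
    (Filter.Eventually.of_forall hw.le_distB) ?_ (by linarith) (by linarith)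
  · refine ((key _ hq).const_sub u).congr_fderiv ?_
    ext v
    simp
  · filter_upwards [hΩ.1.mem_nhds hx] with x' hx' using hw.distB_le x' hx'

end Geometry

section Integration

variable {d : ℕ} {Ω : Set (EuclideanSpace ℝ (Fin d))}

theorem eLpNorm_two_le_ofReal_mul_iff {α : Type*} [MeasurableSpace α] {μ : Measure α} {f g : α → ℝ}
    (hf : MemLp f 2 μ) (hg : MemLp g 2 μ) {a : ℝ} (ha : 0 ≤ a) :
    eLpNorm f 2 μ ≤ ENNReal.ofReal a * eLpNorm g 2 μ ↔
      ∫ x, f x ^ 2 ∂μ ≤ a ^ 2 * ∫ x, g x ^ 2 ∂μ := by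
  have key : ∀ {k : α → ℝ}, MemLp k 2 μ →
      eLpNorm k 2 μ = ENNReal.ofReal (Real.sqrt (∫ x, k x ^ 2 ∂μ)) := by
    intro k hk
    rw [hk.eLpNorm_eq_integral_rpow_norm (by norm_num) (by norm_num), Real.sqrt_eq_rpow]
    simp
  have hg0 : 0 ≤ ∫ x, g x ^ 2 ∂μ := integral_nonneg fun x => sq_nonneg _
  rw [key hf, key hg, ← ENNReal.ofReal_mul ha, ENNReal.ofReal_le_ofReal_iff (by positivity),
    Real.sqrt_le_left (by positivity), mul_pow, Real.sq_sqrt hg0]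

theorem continuous_distB_rpow_mul (hΩ : IsDomainSet Ω) (p : ℝ) {f : EuclideanSpace ℝ (Fin d) → ℝ}
    (hf : Continuous f) (hfΩ : tsupport f ⊆ Ω) : Continuous fun x => distB Ω x ^ p * f x := by
  refine continuous_of_tsupport fun x hx => ?_
  have hxΩ := hfΩ (tsupport_mul_subset_right hx)
  exact ((continuous_distB Ω).continuousAt.rpow_const (Or.inl (hΩ.distB_pos hxΩ).ne')).mul
    hf.continuousAt

theorem integral_sub_mul_sub_eq_neg {φ D : EuclideanSpace ℝ (Fin d) → ℝ} (hφ : Continuous φ)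
    (hφc : HasCompactSupport φ) (hD : Continuous D) (v : EuclideanSpace ℝ (Fin d)) :
    ∫ x, (φ (x + v) - φ x) * (D (x + v) - D x) =
      -∫ x, φ x * (D (x + v) + D (x - v) - 2 * D x) := by
  have hφv : HasCompactSupport fun x => φ (x + v) :=
    hφc.comp_homeomorph (Homeomorph.addRight v)
  have i1 : Integrable fun x => φ (x + v) * D (x + v) :=
    Continuous.integrable_of_hasCompactSupport (by fun_prop) hφv.mul_right
  have i2 : Integrable fun x => φ (x + v) * D x :=
    Continuous.integrable_of_hasCompactSupport (by fun_prop) hφv.mul_right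
  have i3 : Integrable fun x => φ x * D (x + v) :=
    Continuous.integrable_of_hasCompactSupport (by fun_prop) hφc.mul_right
  have i4 : Integrable fun x => φ x * D x :=
    Continuous.integrable_of_hasCompactSupport (by fun_prop) hφc.mul_right
  have i5 : Integrable fun x => φ x * D (x - v) :=
    Continuous.integrable_of_hasCompactSupport (by fun_prop) hφc.mul_right
  have s1 : ∫ x, φ (x + v) * D (x + v) = ∫ x, φ x * D x :=
    integral_add_right_eq_self (fun x => φ x * D x) v
  have s2 : ∫ x, φ (x + v) * D x = ∫ x, φ x * D (x - v) := by
    simpa using integral_add_right_eq_self (fun x => φ x * D (x - v)) v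
  have j1 : Integrable fun x => φ (x + v) * D (x + v) - φ (x + v) * D x := i1.sub i2
  have j2 : Integrable fun x => φ x * D (x + v) - φ x * D x := i3.sub i4
  have j3 : Integrable fun x => φ x * D (x - v) - φ x * D x := i5.sub i4
  have l : ∀ x, (φ (x + v) - φ x) * (D (x + v) - D x) =
      (φ (x + v) * D (x + v) - φ (x + v) * D x) - (φ x * D (x + v) - φ x * D x) := fun x => by ring
  have r : ∀ x, φ x * (D (x + v) + D (x - v) - 2 * D x) =
      (φ x * D (x + v) - φ x * D x) + (φ x * D (x - v) - φ x * D x) := fun x => by ring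
  simp_rw [l, r]
  rw [integral_sub j1 j2, integral_add j2 j3,
    integral_sub i1 i2, integral_sub i3 i4, integral_sub i5 i4, s1, s2]
  ring

theorem exists_pos_le_distB_of_isCompact (hΩ : IsDomainSet Ω) {K : Set (EuclideanSpace ℝ (Fin d))}
    (hK : IsCompact K) (hKΩ : K ⊆ Ω) : ∃ c > 0, ∀ x ∈ K, c ≤ distB Ω x := by
  obtain ⟨c, hc, h⟩ := hK.exists_forall_le' (continuous_distB Ω).continuousOn (a := 0)
    fun x hx => hΩ.distB_pos (hKΩ hx)
  exact ⟨c, hc, h⟩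

theorem abs_integral_difference_quotients_le (hΩ : IsDomainSet Ω) {u : ℝ} (hu : 0 < u)
    (hball : ∀ y ∈ frontier Ω, TwoSidedBall Ω u y) {φ : EuclideanSpace ℝ (Fin d) → ℝ}
    (hφ : Continuous φ) (hφ0 : ∀ x, 0 ≤ φ x) (hφc : HasCompactSupport φ)
    (hφΩ : tsupport φ ⊆ bdryLayer Ω (u / 2)) {c : ℝ} (hc : ∀ x ∈ tsupport φ, c ≤ distB Ω x)
    {e : EuclideanSpace ℝ (Fin d)} (he : ‖e‖ = 1) {h : ℝ} (h0 : 0 < h) (hhc : h < c) :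
    |∫ x, (φ (x + h • e) - φ x) / h * ((distB Ω (x + h • e) - distB Ω x) / h)| ≤
      2 / u * ∫ x, φ x := by
  have e1 : ∀ x, (φ (x + h • e) - φ x) / h * ((distB Ω (x + h • e) - distB Ω x) / h) =
      (h ^ 2)⁻¹ * ((φ (x + h • e) - φ x) * (distB Ω (x + h • e) - distB Ω x)) := fun x => by
    field_simp
  simp_rw [e1]
  rw [integral_const_mul, integral_sub_mul_sub_eq_neg hφ hφc (continuous_distB Ω), mul_neg,
    abs_neg, abs_mul, abs_of_pos (by positivity), inv_mul_le_iff₀ (by positivity),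
    ← integral_const_mul, ← integral_const_mul]
  rw [← Real.norm_eq_abs]
  refine norm_integral_le_of_norm_le ?_ (Filter.Eventually.of_forall fun x => ?_)
  · exact ((hφ.integrable_of_hasCompactSupport hφc).const_mul _).const_mul _
  · rw [norm_mul, Real.norm_of_nonneg (hφ0 x), Real.norm_eq_abs]
    by_cases hx : x ∈ tsupport φ
    · have hv : ‖h • e‖ = h := by rw [norm_smul, he, Real.norm_of_nonneg h0.le, mul_one]
      have := abs_second_difference_distB_le hΩ hu hball (hφΩ hx).1 (hφΩ hx).2.le (v := h • e)
        (by rw [hv]; exact hhc.trans_le (hc x hx))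
      rw [hv] at this
      calc _ ≤ φ x * (2 / u * h ^ 2) := by gcongr; exact hφ0 x
        _ = _ := by ring
    · simp [image_eq_zero_of_notMem_tsupport hx]

/-- The Laplacian of the distance to the boundary is, in the weak sense, bounded near the
boundary. -/
theorem abs_integral_sum_fderiv_mul_fderiv_distB_le (hΩ : IsDomainSet Ω) {u : ℝ} (hu : 0 < u)
    (hball : ∀ y ∈ frontier Ω, TwoSidedBall Ω u y) {φ : EuclideanSpace ℝ (Fin d) → ℝ}
    (hφ : Differentiable ℝ φ) {L : NNReal} (hφL : LipschitzWith L φ) (hφ0 : ∀ x, 0 ≤ φ x)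
    (hφc : HasCompactSupport φ) (hφΩ : tsupport φ ⊆ bdryLayer Ω (u / 2))
    (b : OrthonormalBasis (Fin d) ℝ (EuclideanSpace ℝ (Fin d))) :
    Integrable (fun x => ∑ i, fderiv ℝ φ x (b i) * fderiv ℝ (distB Ω) x (b i)) ∧
    |∫ x, ∑ i, fderiv ℝ φ x (b i) * fderiv ℝ (distB Ω) x (b i)| ≤
      2 * d / u * ∫ x, φ x := by
  obtain ⟨c, hc, hcd⟩ := exists_pos_le_distB_of_isCompact hΩ hφc (fun x hx => (hφΩ hx).1)
  set F : ℝ → EuclideanSpace ℝ (Fin d) → ℝ := fun h x =>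
    ∑ i, (φ (x + h • b i) - φ x) / h * ((distB Ω (x + h • b i) - distB Ω x) / h) with hF
  set K := cthickening 1 (tsupport φ) with hK
  have hKc : IsCompact K := hφc.isCompact.cthickening
  have hFcont : ∀ h, Continuous (F h) := by
    intro h
    have h1 := continuous_distB Ω
    have h2 := hφ.continuous
    simp only [hF]
    fun_prop
  have hsmall : ∀ᶠ h : ℝ in nhdsWithin 0 (Ioi 0), h ∈ Ioo (0 : ℝ) (min c 1) :=
    Ioo_mem_nhdsGT (by positivity)
  have hbound : ∀ h ∈ Ioo (0 : ℝ) (min c 1), ∀ x,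
      ‖F h x‖ ≤ K.indicator (fun _ => (d : ℝ) * L) x := by
    intro h hh x
    have h1 : h < 1 := hh.2.trans_le (min_le_right _ _)
    have hpos : 0 < h := hh.1
    have hdist : ∀ i, dist (x + h • b i) x = h := fun i => by
      rw [dist_eq_norm]
      simp [norm_smul, abs_of_pos hpos]
    by_cases hx : x ∈ K
    · rw [indicator_of_mem hx]
      refine (norm_sum_le _ _).trans ?_
      have : ∀ i ∈ Finset.univ, ‖(φ (x + h • b i) - φ x) / h *
          ((distB Ω (x + h • b i) - distB Ω x) / h)‖ ≤ (L : ℝ) := by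
        intro i _
        have a1 := hφL.dist_le_mul (x + h • b i) x
        have a2 := (lipschitzWith_distB Ω).dist_le_mul (x + h • b i) x
        rw [hdist, Real.dist_eq] at a1 a2
        rw [norm_mul, norm_div, norm_div, Real.norm_of_nonneg hpos.le, Real.norm_eq_abs,
          Real.norm_eq_abs]
        have b1 : |φ (x + h • b i) - φ x| / h ≤ L := by rwa [div_le_iff₀ hpos]
        have b2 : |distB Ω (x + h • b i) - distB Ω x| / h ≤ 1 := by
          rw [div_le_iff₀ hpos]; simpa using a2
        calc _ ≤ (L : ℝ) * 1 := by gcongr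
          _ = L := mul_one _
      refine (Finset.sum_le_sum this).trans_eq (by simp)
    · rw [indicator_of_notMem hx]
      have hx0 : φ x = 0 := image_eq_zero_of_notMem_tsupport fun h =>
        hx (self_subset_cthickening _ h)
      have hxi : ∀ i, φ (x + h • b i) = 0 := fun i => image_eq_zero_of_notMem_tsupport fun hm =>
        hx (mem_cthickening_of_dist_le _ _ _ _ hm (by rw [dist_comm, hdist]; exact h1.le))
      simp [hF, hx0, hxi]
  have hdomi : Integrable (K.indicator (fun _ : EuclideanSpace ℝ (Fin d) => (d : ℝ) * L)) :=
    (integrable_indicator_iff hKc.measurableSet).2 (integrableOn_const hKc.measure_lt_top.ne)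
  have hlim : ∀ x, Filter.Tendsto (fun h => F h x) (nhdsWithin 0 (Ioi 0))
      (nhds (∑ i, fderiv ℝ φ x (b i) * fderiv ℝ (distB Ω) x (b i))) := by
    intro x
    have hquot : ∀ {g : EuclideanSpace ℝ (Fin d) → ℝ}, DifferentiableAt ℝ g x → ∀ i,
        Filter.Tendsto (fun h : ℝ => (g (x + h • b i) - g x) / h) (nhdsWithin 0 (Ioi 0))
          (nhds (fderiv ℝ g x (b i))) := by
      intro g hg i
      have := (hg.hasFDerivAt.hasLineDerivAt (b i)).tendsto_slope_zero_right
      refine this.congr fun h => ?_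
      rw [smul_eq_mul, div_eq_inv_mul]
    by_cases hx : x ∈ tsupport φ
    · obtain ⟨n, -, hn⟩ := exists_hasFDerivAt_distB hΩ hu hball (hφΩ hx).1
        (by linarith [(hφΩ hx).2])
      exact tendsto_finsetSum _ fun i _ =>
        (hquot (hφ x) i).mul (hquot hn.differentiableAt i)
    · have hz : fderiv ℝ φ x = 0 := by
        have : φ =ᶠ[nhds x] 0 := notMem_tsupport_iff_eventuallyEq.1 hx
        rw [this.fderiv_eq]; simp
      simp only [hz, zero_apply, zero_mul, Finset.sum_const_zero]
      refine squeeze_zero_norm' (a := fun h : ℝ => ∑ i, |(φ (x + h • b i) - φ x) / h|)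
        ?_ ?_
      · filter_upwards [hsmall] with h hh
        refine (norm_sum_le _ _).trans (Finset.sum_le_sum fun i _ => ?_)
        have hpos : 0 < h := hh.1
        have a2 := (lipschitzWith_distB Ω).dist_le_mul (x + h • b i) x
        have hdist : dist (x + h • b i) x = h := by
          rw [dist_eq_norm]
          simp [norm_smul, abs_of_pos hpos]
        rw [hdist, Real.dist_eq] at a2
        have b2 : |(distB Ω (x + h • b i) - distB Ω x) / h| ≤ 1 := by
          rw [abs_div, abs_of_pos hpos, div_le_iff₀ hpos]; simpa using a2
        rw [Real.norm_eq_abs, abs_mul]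
        exact mul_le_of_le_one_right (abs_nonneg _) b2
      · have := tendsto_finsetSum Finset.univ fun i _ => (hquot (hφ x) i).abs
        simpa [hz] using this
  have hle : ∀ h ∈ Ioo (0 : ℝ) (min c 1), |∫ x, F h x| ≤ 2 * d / u * ∫ x, φ x := by
    intro h hh
    have hquot : ∀ i, Integrable fun x => (φ (x + h • b i) - φ x) / h *
        ((distB Ω (x + h • b i) - distB Ω x) / h) := by
      intro i
      have h1 := continuous_distB Ω
      have h2 := hφ.continuous
      refine Continuous.integrable_of_hasCompactSupport (by fun_prop) ?_
      have hv : HasCompactSupport fun x => φ (x + h • b i) :=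
        hφc.comp_homeomorph (Homeomorph.addRight (h • b i))
      have hq : HasCompactSupport fun x => (φ (x + h • b i) - φ x) / h := by
        simp_rw [div_eq_mul_inv]
        exact (hv.sub hφc).mul_right (f' := fun _ => h⁻¹)
      exact hq.mul_right
    rw [hF, integral_finsetSum _ fun i _ => hquot i]
    refine (Finset.abs_sum_le_sum_abs _ _).trans ((Finset.sum_le_sum fun i _ =>
      abs_integral_difference_quotients_le hΩ hu hball hφ.continuous hφ0 hφc hφΩ hcd
        (b.norm_eq_one i) hh.1 (hh.2.trans_le (min_le_left _ _))).trans_eq ?_)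
    simp
    ring
  refine ⟨hdomi.mono' ?_ (Filter.Eventually.of_forall fun x => ?_), ?_⟩
  · exact (Finset.measurable_fun_sum _ fun i _ => (measurable_fderiv_apply_const ℝ φ (b i)).mul
      (measurable_fderiv_apply_const ℝ (distB Ω) (b i))).aestronglyMeasurable
  · exact le_of_tendsto (hlim x).norm (hsmall.mono fun h hh => hbound h hh x)
  · have := tendsto_integral_filter_of_dominated_convergence (μ := volume)
      (K.indicator (fun _ : EuclideanSpace ℝ (Fin d) => (d : ℝ) * L))
      (Filter.Eventually.of_forall fun h => (hFcont h).aestronglyMeasurable)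
      (hsmall.mono fun h hh => Filter.Eventually.of_forall fun x => hbound h hh x)
      hdomi (Filter.Eventually.of_forall hlim)
    exact le_of_tendsto this.abs (hsmall.mono hle)

end Integration

section UpperBound

variable {d : ℕ} {Ω : Set (EuclideanSpace ℝ (Fin d))}

theorem memLp_distB_rpow_mul (hΩ : IsDomainSet Ω) (p : ℝ) {f : EuclideanSpace ℝ (Fin d) → ℝ}
    (hf : Continuous f) (hfc : HasCompactSupport f) (hfΩ : tsupport f ⊆ Ω) :
    MemLp (fun x => distB Ω x ^ p * f x) 2 volume :=
  (continuous_distB_rpow_mul hΩ p hf hfΩ).memLp_of_hasCompactSupport hfc.mul_left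

theorem integrable_distB_rpow_mul (hΩ : IsDomainSet Ω) (p : ℝ)
    {f : EuclideanSpace ℝ (Fin d) → ℝ} (hf : Continuous f) (hfc : HasCompactSupport f)
    (hfΩ : tsupport f ⊆ Ω) : Integrable fun x => distB Ω x ^ p * f x :=
  (continuous_distB_rpow_mul hΩ p hf hfΩ).integrable_of_hasCompactSupport hfc.mul_left

theorem rpow_mul_sq {t : ℝ} (ht : 0 ≤ t) (p s : ℝ) : (t ^ p * s) ^ 2 = t ^ (2 * p) * s ^ 2 := by
  rw [mul_pow, ← Real.rpow_mul_natCast ht, mul_comm p]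
  norm_num

theorem tsupport_norm_fderiv_subset (ψ : EuclideanSpace ℝ (Fin d) → ℝ) :
    tsupport (fun x => ‖fderiv ℝ ψ x‖) ⊆ tsupport ψ :=
  (closure_mono fun x hx => by simpa using hx).trans (tsupport_fderiv_subset ℝ)

theorem sum_apply_mul_inner_eq {ι F : Type*} [Fintype ι] [NormedAddCommGroup F]
    [InnerProductSpace ℝ F] (b : OrthonormalBasis ι ℝ F) (l : F →L[ℝ] ℝ) (n : F) :
    ∑ i, l (b i) * ⟪n, b i⟫ = l n := by
  conv_rhs => rw [← b.sum_repr' n]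
  rw [map_sum]
  refine Finset.sum_congr rfl fun i _ => ?_
  rw [map_smul, smul_eq_mul, mul_comm, real_inner_comm]

/-- The Hardy inequality on the boundary layer `Γ_r`, with a constant that tends to `2/|δ-1|` as
`r → 0`. -/
theorem bHardy_bdryLayer (hΩ : IsDomainSet Ω) {u : ℝ} (hu : 0 < u)
    (hball : ∀ y ∈ frontier Ω, TwoSidedBall Ω u y) (δ : ℝ) {r : ℝ} (hr : r ≤ u / 2)
    (hκ : 0 < |δ - 1| - 2 * d / u * r) :
    BHardy Ω δ (bdryLayer Ω r) (2 / (|δ - 1| - 2 * d / u * r)) := by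
  rintro ψ ⟨hψ, hψc, hψr⟩
  set κ := |δ - 1| - 2 * d / u * r with hκdef
  have hψΩ : tsupport ψ ⊆ Ω := fun x hx => (hψr hx).1
  have hDcont : Continuous (fderiv ℝ ψ) := hψ.continuous_fderiv (by norm_num)
  have hψcont := hψ.continuous
  have hDc : HasCompactSupport fun x => ‖fderiv ℝ ψ x‖ := (hψc.fderiv ℝ).norm
  have hDΩ : tsupport (fun x => ‖fderiv ℝ ψ x‖) ⊆ Ω :=
    (tsupport_norm_fderiv_subset ψ).trans hψΩ
  have hψ2Ω : tsupport (fun x => ψ x ^ 2) ⊆ Ω :=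
    (closure_mono fun x hx => by simpa using hx : tsupport (fun x => ψ x ^ 2) ⊆ tsupport ψ).trans
      hψΩ
  have hψ2c : HasCompactSupport fun x => ψ x ^ 2 := hψc.comp_left (g := fun t => t ^ 2) (by simp)
  have hD2Ω : tsupport (fun x => ‖fderiv ℝ ψ x‖ ^ 2) ⊆ Ω :=
    (closure_mono fun x hx => by simpa using hx :
      tsupport (fun x => ‖fderiv ℝ ψ x‖ ^ 2) ⊆ tsupport fun x => ‖fderiv ℝ ψ x‖).trans hDΩ
  have hD2c : HasCompactSupport fun x => ‖fderiv ℝ ψ x‖ ^ 2 :=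
    hDc.comp_left (g := fun t => t ^ 2) (by simp)
  have hmΩ : tsupport (fun x => |ψ x| * ‖fderiv ℝ ψ x‖) ⊆ Ω := tsupport_mul_subset_right.trans hDΩ
  have hmc : HasCompactSupport fun x => |ψ x| * ‖fderiv ℝ ψ x‖ := hDc.mul_left
  rw [wNorm, wGradNorm, L2N, L2N, eLpNorm_two_le_ofReal_mul_iff
    (memLp_distB_rpow_mul hΩ _ hψ.continuous hψc hψΩ)
    (memLp_distB_rpow_mul hΩ _ hDcont.norm hDc hDΩ) (by positivity)]
  simp_rw [rpow_mul_sq (distB_nonneg Ω _)]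
  rw [show 2 * (δ / 2 - 1) = δ - 2 by ring, show 2 * (δ / 2) = δ by ring]
  have hA : Integrable fun x => distB Ω x ^ (δ - 2) * ψ x ^ 2 :=
    integrable_distB_rpow_mul hΩ _ (by fun_prop) hψ2c hψ2Ω
  have hB : Integrable fun x => distB Ω x ^ δ * ‖fderiv ℝ ψ x‖ ^ 2 :=
    integrable_distB_rpow_mul hΩ _ (by fun_prop) hD2c hD2Ω
  set A := ∫ x, distB Ω x ^ (δ - 2) * ψ x ^ 2 with hAdef
  set B := ∫ x, distB Ω x ^ δ * ‖fderiv ℝ ψ x‖ ^ 2 with hBdef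
  set φ : EuclideanSpace ℝ (Fin d) → ℝ := fun x => distB Ω x ^ (δ - 1) * ψ x ^ 2 with hφdef
  have hφcont : Continuous φ := continuous_distB_rpow_mul hΩ _ (by fun_prop) hψ2Ω
  have hφsupp : tsupport φ ⊆ tsupport ψ :=
    tsupport_mul_subset_right.trans (closure_mono fun x hx => by simpa using hx)
  have hφc : HasCompactSupport φ := hψ2c.mul_left
  have hφ0 : ∀ x, 0 ≤ φ x := fun x =>
    mul_nonneg (Real.rpow_nonneg (distB_nonneg Ω x) _) (sq_nonneg _)
  have hoff : ∀ x ∉ tsupport ψ, φ =ᶠ[nhds x] 0 := fun x hx =>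
    notMem_tsupport_iff_eventuallyEq.1 fun h => hx (hφsupp h)
  have hon : ∀ x ∈ tsupport ψ, ∃ n : EuclideanSpace ℝ (Fin d), ‖n‖ = 1 ∧
      HasFDerivAt (distB Ω) (innerSL ℝ n) x ∧ HasFDerivAt φ
        (distB Ω x ^ (δ - 1) • (2 * ψ x) • fderiv ℝ ψ x +
          ψ x ^ 2 • ((δ - 1) * distB Ω x ^ (δ - 2)) • innerSL ℝ n) x := by
    intro x hx
    obtain ⟨n, hn, hnd⟩ := exists_hasFDerivAt_distB hΩ hu hball (hψΩ hx)
      (by linarith [(hψr hx).2])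
    refine ⟨n, hn, hnd, ?_⟩
    have h1 := hnd.rpow_const (p := δ - 1) (Or.inl (hΩ.distB_pos (hψΩ hx)).ne')
    have h2 := ((hψ.differentiable (by norm_num)) x).hasFDerivAt.pow 2
    refine (h1.mul h2).congr_fderiv ?_
    rw [show δ - 1 - 1 = δ - 2 by ring]
    simp
  have hφdiff : Differentiable ℝ φ := by
    intro x
    by_cases hx : x ∈ tsupport ψ
    · obtain ⟨n, -, -, h⟩ := hon x hx
      exact h.differentiableAt
    · exact (differentiableAt_const (0 : ℝ)).congr_of_eventuallyEq (hoff x hx)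
  set M : EuclideanSpace ℝ (Fin d) → ℝ := fun x =>
    2 * (distB Ω x ^ (δ - 1) * (|ψ x| * ‖fderiv ℝ ψ x‖)) +
      |δ - 1| * (distB Ω x ^ (δ - 2) * ψ x ^ 2) with hMdef
  have hM0 : ∀ x, 0 ≤ M x := fun x => by
    have h1 := Real.rpow_nonneg (distB_nonneg Ω x) (δ - 1)
    have h2 := Real.rpow_nonneg (distB_nonneg Ω x) (δ - 2)
    positivity
  have hDM : ∀ x, ‖fderiv ℝ φ x‖ ≤ M x := by
    intro x
    by_cases hx : x ∈ tsupport ψ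
    · obtain ⟨n, hn, -, h⟩ := hon x hx
      have h1 := Real.rpow_nonneg (distB_nonneg Ω x) (δ - 1)
      have h2 := Real.rpow_nonneg (distB_nonneg Ω x) (δ - 2)
      rw [h.fderiv]
      refine (norm_add_le _ _).trans_eq ?_
      simp only [norm_smul, innerSL_apply_norm, hn, Real.norm_eq_abs, abs_mul, abs_of_nonneg h1,
        abs_of_nonneg h2, abs_pow, sq_abs, abs_two, hMdef]
      ring
    · rw [(hoff x hx).fderiv_eq]
      simpa using hM0 x
  have hMcont : Continuous M :=
    ((continuous_distB_rpow_mul hΩ _ (by fun_prop) hmΩ).const_mul 2).add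
      ((continuous_distB_rpow_mul hΩ _ (by fun_prop) hψ2Ω).const_mul _)
  obtain ⟨C, hC⟩ := hMcont.bounded_above_of_compact_support
    ((HasCompactSupport.mul_left (f := fun _ => (2 : ℝ)) hmc.mul_left).add
      (HasCompactSupport.mul_left (f := fun _ => |δ - 1|) hψ2c.mul_left))
  have hlip : LipschitzWith C.toNNReal φ := by
    refine lipschitzWith_of_nnnorm_fderiv_le hφdiff fun x => ?_
    rw [← NNReal.coe_le_coe, coe_nnnorm]
    exact (hDM x).trans ((le_abs_self _).trans ((hC x).trans (Real.le_coe_toNNReal C)))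
  obtain ⟨hFi, hF⟩ := abs_integral_sum_fderiv_mul_fderiv_distB_le hΩ hu hball hφdiff hlip hφ0 hφc
    (hφsupp.trans fun x hx => ⟨(hψr hx).1, (hψr hx).2.trans_le hr⟩)
    (EuclideanSpace.basisFun (Fin d) ℝ)
  set F : EuclideanSpace ℝ (Fin d) → ℝ := fun x => ∑ i,
    fderiv ℝ φ x (EuclideanSpace.basisFun (Fin d) ℝ i) *
      fderiv ℝ (distB Ω) x (EuclideanSpace.basisFun (Fin d) ℝ i) with hFdef
  have hφA : ∫ x, φ x ≤ r * A := by
    rw [hAdef, ← integral_const_mul]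
    refine integral_mono (hφcont.integrable_of_hasCompactSupport hφc) (hA.const_mul r) fun x => ?_
    by_cases hx : x ∈ tsupport ψ
    · have hpos := hΩ.distB_pos (hψΩ hx)
      have : distB Ω x ^ (δ - 1) = distB Ω x ^ (δ - 2) * distB Ω x := by
        rw [← Real.rpow_add_one hpos.ne']; ring_nf
      have hnn : 0 ≤ distB Ω x ^ (δ - 2) * ψ x ^ 2 := by positivity
      simp only [hφdef, this]
      nlinarith [(hψr hx).2]
    · simp [hφdef, image_eq_zero_of_notMem_tsupport hx]
  have hrem : ∀ x, ‖F x - (δ - 1) * (distB Ω x ^ (δ - 2) * ψ x ^ 2)‖ ≤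
      κ / 2 * (distB Ω x ^ (δ - 2) * ψ x ^ 2) +
        2 / κ * (distB Ω x ^ δ * ‖fderiv ℝ ψ x‖ ^ 2) := by
    intro x
    by_cases hx : x ∈ tsupport ψ
    · obtain ⟨n, hn, hnd, h⟩ := hon x hx
      have hpos := hΩ.distB_pos (hψΩ hx)
      have e1 : distB Ω x ^ (δ - 1) = distB Ω x ^ (δ - 2) * distB Ω x := by
        rw [← Real.rpow_add_one hpos.ne']; ring_nf
      have e2 : distB Ω x ^ δ = distB Ω x ^ (δ - 2) * distB Ω x ^ 2 := by
        rw [← Real.rpow_add_natCast hpos.ne']; norm_num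
      have hFx : F x = distB Ω x ^ (δ - 1) * (2 * ψ x * fderiv ℝ ψ x n) +
          (δ - 1) * (distB Ω x ^ (δ - 2) * ψ x ^ 2) := by
        simp only [hFdef, hnd.fderiv, innerSL_apply_apply]
        rw [sum_apply_mul_inner_eq, h.fderiv]
        simp [hn]
        ring
      rw [hFx, add_sub_cancel_right, e1, e2]
      set q := distB Ω x ^ (δ - 2)
      have hq : 0 ≤ q := Real.rpow_nonneg hpos.le _
      set T := distB Ω x * ‖fderiv ℝ ψ x‖ with hT
      have hn' : |fderiv ℝ ψ x n| ≤ ‖fderiv ℝ ψ x‖ := by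
        simpa [hn] using (fderiv ℝ ψ x).le_opNorm n
      calc ‖q * distB Ω x * (2 * ψ x * fderiv ℝ ψ x n)‖
          = q * (2 * |ψ x| * (distB Ω x * |fderiv ℝ ψ x n|)) := by
            simp only [norm_mul, Real.norm_eq_abs, abs_of_nonneg hq, abs_of_pos hpos, abs_two]
            ring
        _ ≤ q * (2 * |ψ x| * T) := by rw [hT]; gcongr
        _ ≤ q * (κ / 2 * |ψ x| ^ 2 + 2 / κ * T ^ 2) := by
            gcongr
            have : κ / 2 * |ψ x| ^ 2 + 2 / κ * T ^ 2 - 2 * |ψ x| * T =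
                κ / 2 * (|ψ x| - 2 / κ * T) ^ 2 := by
              field_simp
              ring
            rw [← sub_nonneg, this]
            positivity
        _ = _ := by rw [sq_abs, hT]; ring
    · have hψ0 := image_eq_zero_of_notMem_tsupport hx
      have hf0 : fderiv ℝ φ x = 0 := by rw [(hoff x hx).fderiv_eq]; simp
      have hF0 : F x = 0 := by simp [hFdef, hf0]
      rw [hF0, hψ0]
      have := Real.rpow_nonneg (distB_nonneg Ω x) δ
      simp only [ne_eq, OfNat.ofNat_ne_zero, not_false_eq_true, zero_pow, mul_zero, sub_zero,
        norm_zero, zero_add]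
      positivity
  have h1 : ‖∫ x, F x - (δ - 1) * (distB Ω x ^ (δ - 2) * ψ x ^ 2)‖ ≤ κ / 2 * A + 2 / κ * B := by
    rw [hAdef, hBdef, ← integral_const_mul, ← integral_const_mul,
      ← integral_add (hA.const_mul _) (hB.const_mul _)]
    exact norm_integral_le_of_norm_le ((hA.const_mul _).add (hB.const_mul _))
      (Filter.Eventually.of_forall hrem)
  rw [integral_sub hFi (hA.const_mul _), integral_const_mul, ← hAdef, Real.norm_eq_abs] at h1
  have hA0 : 0 ≤ A := integral_nonneg fun x =>
    mul_nonneg (Real.rpow_nonneg (distB_nonneg Ω x) _) (sq_nonneg _)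
  have h2 : |δ - 1| * A ≤ |∫ x, F x| + (κ / 2 * A + 2 / κ * B) := by
    rw [← abs_of_nonneg hA0, ← abs_mul, abs_of_nonneg hA0]
    have := abs_sub_abs_le_abs_sub ((δ - 1) * A) (∫ x, F x)
    rw [abs_sub_comm] at this
    linarith
  have h3 : |∫ x, F x| ≤ 2 * d / u * r * A := by
    refine hF.trans ?_
    rw [mul_assoc]
    gcongr
  have h4 : κ / 2 * A ≤ 2 / κ * B := by
    have : κ * A = |δ - 1| * A - 2 * d / u * r * A := by rw [hκdef]; ring
    linarith
  calc A = 2 / κ * (κ / 2 * A) := by field_simp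
    _ ≤ 2 / κ * (2 / κ * B) := by gcongr
    _ = (2 / κ) ^ 2 * B := by ring

end UpperBound

section BlowUp

variable {d : ℕ} {Ω : Set (EuclideanSpace ℝ (Fin d))}

/-- The linear map multiplying the component along the unit vector `n` by `k`. -/
def stretch (n : EuclideanSpace ℝ (Fin d)) (k : ℝ) :
    EuclideanSpace ℝ (Fin d) →L[ℝ] EuclideanSpace ℝ (Fin d) :=
  ContinuousLinearMap.id ℝ _ + (k - 1) • (innerSL ℝ n).smulRight n

theorem stretch_apply (n : EuclideanSpace ℝ (Fin d)) (k : ℝ) (x : EuclideanSpace ℝ (Fin d)) :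
    stretch n k x = x + ((k - 1) * ⟪n, x⟫) • n := by
  simp [stretch, smul_smul]

theorem inner_stretch {n : EuclideanSpace ℝ (Fin d)} (hn : ‖n‖ = 1) (k : ℝ)
    (x : EuclideanSpace ℝ (Fin d)) : ⟪n, stretch n k x⟫ = k * ⟪n, x⟫ := by
  rw [stretch_apply, inner_add_right, inner_smul_right, real_inner_self_eq_norm_sq, hn]
  ring

theorem stretch_stretch {n : EuclideanSpace ℝ (Fin d)} (hn : ‖n‖ = 1) {k l : ℝ} (hkl : k * l = 1)
    (x : EuclideanSpace ℝ (Fin d)) : stretch n k (stretch n l x) = x := by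
  rw [stretch_apply, inner_stretch hn, stretch_apply, add_assoc, ← add_smul]
  have : (l - 1) * ⟪n, x⟫ + (k - 1) * (l * ⟪n, x⟫) = 0 := by linear_combination ⟪n, x⟫ * hkl
  rw [this, zero_smul, add_zero]

theorem norm_stretch_sq {n : EuclideanSpace ℝ (Fin d)} (hn : ‖n‖ = 1) (k : ℝ)
    (x : EuclideanSpace ℝ (Fin d)) :
    ‖stretch n k x‖ ^ 2 = ‖x‖ ^ 2 + (k ^ 2 - 1) * ⟪n, x⟫ ^ 2 := by
  rw [stretch_apply, norm_add_sq_real, inner_smul_right, norm_smul, hn, real_inner_comm, mul_one,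
    Real.norm_eq_abs, sq_abs]
  ring

/-- The anisotropic scaling by `s ^ 3` along `n` and by `s ^ 2` orthogonally to it. -/
def parabolicScaling {n : EuclideanSpace ℝ (Fin d)} (hn : ‖n‖ = 1) {s : ℝ} (hs : 0 < s) :
    EuclideanSpace ℝ (Fin d) ≃L[ℝ] EuclideanSpace ℝ (Fin d) :=
  ContinuousLinearEquiv.equivOfInverse (s ^ 2 • stretch n s) ((s ^ 2)⁻¹ • stretch n s⁻¹)
    (fun x => by
      simp only [smul_apply, map_smul, smul_smul]
      rw [mul_inv_cancel₀ (by positivity), one_smul, stretch_stretch hn (inv_mul_cancel₀ hs.ne')])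
    (fun x => by
      simp only [smul_apply, map_smul, smul_smul]
      rw [inv_mul_cancel₀ (by positivity), one_smul, stretch_stretch hn (mul_inv_cancel₀ hs.ne')])

theorem TouchingBalls.distB_parabolicScaling {u : ℝ} (hu : 0 < u)
    {y n : EuclideanSpace ℝ (Fin d)} (hn : ‖n‖ = 1) (hw : TouchingBalls Ω u y (u • n))
    {s : ℝ} (hs : 0 < s) (hs1 : s ≤ 1) {x : EuclideanSpace ℝ (Fin d)}
    (hx : s * (‖x‖ ^ 2 / (2 * u)) < ⟪n, x⟫) :
    y + s ^ 2 • stretch n s x ∈ Ω ∧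
      |distB Ω (y + s ^ 2 • stretch n s x) / s ^ 3 - ⟪n, x⟫| ≤ s * (‖x‖ ^ 2 / (2 * u)) := by
  set v := s ^ 2 • stretch n s x with hv
  set t := ⟪n, x⟫ with ht
  have hvn : ⟪v, u • n⟫ = u * s ^ 3 * t := by
    rw [hv, real_inner_comm, inner_smul_left, inner_smul_right, inner_stretch hn]
    simp
    ring
  have hvv : ‖v‖ ^ 2 ≤ s ^ 4 * ‖x‖ ^ 2 := by
    rw [hv, norm_smul, mul_pow, norm_stretch_sq hn, Real.norm_of_nonneg (by positivity)]
    have : (s ^ 2 - 1) * ⟪n, x⟫ ^ 2 ≤ 0 :=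
      mul_nonpos_of_nonpos_of_nonneg (by nlinarith) (sq_nonneg _)
    nlinarith [pow_pos hs 4]
  have hun : ‖u • n‖ = u := hw.norm_eq
  have amgm : ∀ z : EuclideanSpace ℝ (Fin d), ‖z‖ - u ≤ (‖z‖ ^ 2 - u ^ 2) / (2 * u) := fun z => by
    rw [le_div_iff₀ (by positivity)]
    nlinarith [sq_nonneg (‖z‖ - u)]
  have hX : (s ^ 4 * ‖x‖ ^ 2) / (2 * u) = s ^ 3 * (s * (‖x‖ ^ 2 / (2 * u))) := by ring
  have lower : s ^ 3 * (t - s * (‖x‖ ^ 2 / (2 * u))) ≤ u - ‖v - u • n‖ := by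
    have h1 := amgm (v - u • n)
    rw [norm_sub_sq_real, hvn, hun] at h1
    have h2 : (‖v‖ ^ 2 - 2 * (u * s ^ 3 * t) + u ^ 2 - u ^ 2) / (2 * u) ≤
        (s ^ 4 * ‖x‖ ^ 2) / (2 * u) - s ^ 3 * t := by
      rw [div_sub' (by positivity), div_le_div_iff_of_pos_right (by positivity)]
      nlinarith
    rw [hX] at h2
    linarith
  have upper : ‖v + u • n‖ - u ≤ s ^ 3 * (t + s * (‖x‖ ^ 2 / (2 * u))) := by
    have h1 := amgm (v + u • n)
    rw [norm_add_sq_real, hvn, hun] at h1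
    have h2 : (‖v‖ ^ 2 + 2 * (u * s ^ 3 * t) + u ^ 2 - u ^ 2) / (2 * u) ≤
        (s ^ 4 * ‖x‖ ^ 2) / (2 * u) + s ^ 3 * t := by
      rw [div_add' _ _ _ (by positivity), div_le_div_iff_of_pos_right (by positivity)]
      nlinarith
    rw [hX] at h2
    linarith
  have hs3 : 0 < s ^ 3 := by positivity
  have e1 : y + v - (y + u • n) = v - u • n := by abel
  have e2 : y + v - (y - u • n) = v + u • n := by abel
  have hmem : y + v ∈ Ω := by
    refine hw.ball_subset ?_
    rw [mem_ball, dist_eq_norm, e1]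
    have := mul_pos hs3 (sub_pos.2 hx)
    linarith
  have h1 := hw.le_distB (y + v)
  have h2 := hw.distB_le _ hmem
  rw [e1] at h1
  rw [e2] at h2
  refine ⟨hmem, ?_⟩
  rw [abs_le]
  constructor
  · rw [neg_le_sub_iff_le_add, ← sub_le_iff_le_add, le_div_iff₀ hs3]
    linarith
  · rw [sub_le_iff_le_add, div_le_iff₀ hs3]
    linarith

theorem eLpNorm_comp_affine_le {f g : EuclideanSpace ℝ (Fin d) → ℝ} {C : ℝ≥0∞}
    (h : eLpNorm f 2 volume ≤ C * eLpNorm g 2 volume)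
    (A : EuclideanSpace ℝ (Fin d) ≃L[ℝ] EuclideanSpace ℝ (Fin d))
    (y : EuclideanSpace ℝ (Fin d)) :
    eLpNorm (fun x => f (y + A x)) 2 volume ≤ C * eLpNorm (fun x => g (y + A x)) 2 volume := by
  have hdet : LinearMap.det (A.toLinearEquiv : EuclideanSpace ℝ (Fin d) →ₗ[ℝ] _) ≠ 0 :=
    A.toLinearEquiv.isUnit_det'.ne_zero
  have hA := Measure.map_linearMap_addHaar_eq_smul_addHaar
    (volume : Measure (EuclideanSpace ℝ (Fin d))) hdet
  have key : ∀ k : EuclideanSpace ℝ (Fin d) → ℝ, eLpNorm (fun x => k (y + A x)) 2 volume =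
      ENNReal.ofReal |(LinearMap.det (A.toLinearEquiv : EuclideanSpace ℝ (Fin d) →ₗ[ℝ] _))⁻¹| ^
        (1 / (2 : ℝ≥0∞)).toReal * eLpNorm k 2 volume := by
    intro k
    have e1 : eLpNorm k 2 (Measure.map (fun x => y + A x) volume) =
        eLpNorm (fun x => k (y + A x)) 2 volume :=
      ((A.toHomeomorph.trans (Homeomorph.addLeft y)).measurableEmbedding).eLpNorm_map_measure
    have e2 : Measure.map (fun x => y + A x) volume =
        ENNReal.ofReal |(LinearMap.det (A.toLinearEquiv : EuclideanSpace ℝ (Fin d) →ₗ[ℝ] _))⁻¹| •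
          (volume : Measure (EuclideanSpace ℝ (Fin d))) := by
      have hA' : Measure.map A volume = _ := hA
      have hc : (fun x => y + A x) = (fun x => y + x) ∘ A := rfl
      rw [hc, ← Measure.map_map (by fun_prop) (by fun_prop), hA', Measure.map_smul, map_add_left_eq_self]
    rw [← e1, e2, eLpNorm_smul_measure_of_ne_top (by norm_num), smul_eq_mul]
  rw [key, key, mul_left_comm]
  gcongr

end BlowUp

section DirectionalHardy

variable {d : ℕ} {Ω : Set (EuclideanSpace ℝ (Fin d))}

theorem rpow_le_rpow_add_rpow {α β x : ℝ} (hα : 0 < α) (hαx : α ≤ x) (hxβ : x ≤ β) (p : ℝ) :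
    x ^ p ≤ α ^ p + β ^ p := by
  have hx : 0 < x := hα.trans_le hαx
  have h1 : 0 ≤ α ^ p := Real.rpow_nonneg hα.le p
  have h2 : 0 ≤ β ^ p := Real.rpow_nonneg (hx.le.trans hxβ) p
  rcases le_total 0 p with hp | hp
  · linarith [Real.rpow_le_rpow hx.le hxβ hp]
  · linarith [Real.rpow_le_rpow_of_nonpos hα hαx hp]

/-- The Hardy inequality transported to the parabolically rescaled domain. -/
theorem BHardy.integral_rescaled_le (hΩ : IsDomainSet Ω) {δ r a : ℝ} (ha : 0 ≤ a)
    (hH : BHardy Ω δ (bdryLayer Ω r) a) {n : EuclideanSpace ℝ (Fin d)} (hn : ‖n‖ = 1)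
    (y : EuclideanSpace ℝ (Fin d)) {s : ℝ} (hs : 0 < s) {ψ : EuclideanSpace ℝ (Fin d) → ℝ}
    (hψ : ContDiff ℝ 1 ψ) (hψc : HasCompactSupport ψ)
    (hmem : ∀ x ∈ tsupport ψ, y + s ^ 2 • stretch n s x ∈ bdryLayer Ω r) :
    ∫ x, (distB Ω (y + s ^ 2 • stretch n s x) / s ^ 3) ^ (δ - 2) * ψ x ^ 2 ≤
      a ^ 2 * ∫ x, (distB Ω (y + s ^ 2 • stretch n s x) / s ^ 3) ^ δ *
        ‖s • fderiv ℝ ψ x + ((1 - s) * fderiv ℝ ψ x n) • innerSL ℝ n‖ ^ 2 := by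
  set A := parabolicScaling hn hs with hA
  have hAx : ∀ x, s ^ 2 • stretch n s x = A x := fun x => rfl
  simp_rw [hAx] at hmem ⊢
  set T : EuclideanSpace ℝ (Fin d) ≃ₜ EuclideanSpace ℝ (Fin d) :=
    A.toHomeomorph.trans (Homeomorph.addLeft y) with hT
  have hTx : ∀ x, T x = y + A x := fun x => rfl
  set B : EuclideanSpace ℝ (Fin d) →L[ℝ] EuclideanSpace ℝ (Fin d) :=
    A.symm.toContinuousLinearMap with hB
  set f : EuclideanSpace ℝ (Fin d) → ℝ := fun x => ψ (B (x - y)) with hf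
  have hfT : f = ψ ∘ T.symm := by
    funext x
    have : B (x - y) = T.symm x := by
      rw [Homeomorph.eq_symm_apply, hTx, hB]
      simp
    rw [Function.comp_apply, ← this]
  have hBA : ∀ x, B (y + A x - y) = x := fun x => by simp [hB]
  have hfdiff : ContDiff ℝ 1 f := by fun_prop
  have hfc : HasCompactSupport f := hfT ▸ hψc.comp_homeomorph T.symm
  have hfs : tsupport f ⊆ bdryLayer Ω r := by
    intro x hx
    rw [hfT] at hx
    have := hmem _ (tsupport_comp_subset_preimage ψ T.symm.continuous hx)
    rwa [← hTx, T.apply_symm_apply] at this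
  have hfΩ : tsupport f ⊆ Ω := fun x hx => (hfs hx).1
  have hDcont : Continuous (fderiv ℝ f) := hfdiff.continuous_fderiv (by norm_num)
  have hDf : ∀ x, fderiv ℝ f (y + A x) = (fderiv ℝ ψ x).comp B := by
    intro x
    have h1 : HasFDerivAt ψ (fderiv ℝ ψ x) (B (y + A x - y)) := by
      rw [hBA]
      exact (hψ.differentiable (by norm_num) x).hasFDerivAt
    have h2 : HasFDerivAt (fun z => B (z - y)) B (y + A x) :=
      B.hasFDerivAt.comp (y + A x) ((hasFDerivAt_id (y + A x)).sub_const y)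
    have h3 := HasFDerivAt.comp (y + A x) h1 h2
    exact h3.fderiv
  have hDc : HasCompactSupport fun x => ‖fderiv ℝ f x‖ := (hfc.fderiv ℝ).norm
  have hDΩ : tsupport (fun x => ‖fderiv ℝ f x‖) ⊆ Ω := (tsupport_norm_fderiv_subset f).trans hfΩ
  have hineq := eLpNorm_comp_affine_le (hH f ⟨hfdiff, hfc, hfs⟩) A y
  have hmem1 : MemLp (fun x => distB Ω (y + A x) ^ (δ / 2 - 1) * f (y + A x)) 2 volume :=
    ((continuous_distB_rpow_mul hΩ _ hfdiff.continuous hfΩ).comp T.continuous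
      ).memLp_of_hasCompactSupport (hfc.mul_left.comp_homeomorph T)
  have hmem2 : MemLp (fun x => distB Ω (y + A x) ^ (δ / 2) * ‖fderiv ℝ f (y + A x)‖) 2 volume :=
    ((continuous_distB_rpow_mul hΩ _ hDcont.norm hDΩ).comp T.continuous
      ).memLp_of_hasCompactSupport (hDc.mul_left.comp_homeomorph T)
  rw [eLpNorm_two_le_ofReal_mul_iff hmem1 hmem2 ha] at hineq
  simp_rw [rpow_mul_sq (distB_nonneg Ω _), hDf] at hineq
  rw [show 2 * (δ / 2 - 1) = δ - 2 by ring, show 2 * (δ / 2) = δ by ring] at hineq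
  have hs3 : 0 < s ^ 3 := by positivity
  have hfA : ∀ x, f (y + A x) = ψ x := fun x => by rw [hf]; simp only [hBA]
  simp_rw [hfA] at hineq
  have hcomp : ∀ x, s • fderiv ℝ ψ x + ((1 - s) * fderiv ℝ ψ x n) • innerSL ℝ n =
      s ^ 3 • (fderiv ℝ ψ x).comp B := by
    intro x
    ext v
    have hBv : B v = (s ^ 2)⁻¹ • stretch n s⁻¹ v := rfl
    simp only [add_apply, smul_apply, ContinuousLinearMap.comp_apply, hBv, innerSL_apply_apply,
      smul_eq_mul, map_smul, stretch_apply, map_add]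
    field_simp
  have e1 : ∀ x, (distB Ω (y + A x) / s ^ 3) ^ (δ - 2) * ψ x ^ 2 =
      ((s ^ 3) ^ (δ - 2))⁻¹ * (distB Ω (y + A x) ^ (δ - 2) * ψ x ^ 2) := fun x => by
    rw [Real.div_rpow (distB_nonneg Ω _) hs3.le]
    ring
  have e2 : ∀ x, (distB Ω (y + A x) / s ^ 3) ^ δ *
      ‖s • fderiv ℝ ψ x + ((1 - s) * fderiv ℝ ψ x n) • innerSL ℝ n‖ ^ 2 =
      ((s ^ 3) ^ (δ - 2))⁻¹ * (distB Ω (y + A x) ^ δ * ‖(fderiv ℝ ψ x).comp B‖ ^ 2) := fun x => by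
    have h3 : (s ^ 3) ^ δ = (s ^ 3) ^ (δ - 2) * (s ^ 3) ^ 2 := by
      rw [← Real.rpow_add_natCast hs3.ne']
      norm_num
    have h4 : 0 < (s ^ 3) ^ (δ - 2) := Real.rpow_pos_of_pos hs3 _
    rw [hcomp, norm_smul, Real.div_rpow (distB_nonneg Ω _) hs3.le, Real.norm_of_nonneg hs3.le, h3]
    field_simp
  simp_rw [e1, e2]
  rw [integral_const_mul, integral_const_mul, mul_left_comm]
  have h4 : 0 < (s ^ 3) ^ (δ - 2) := Real.rpow_pos_of_pos hs3 _
  gcongr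

/-- Blowing up at a boundary point, the boundary Hardy inequality yields a Hardy inequality on a
half-space that involves only the normal derivative. -/
theorem BHardy.integral_halfSpace_le (hΩ : IsDomainSet Ω) {u : ℝ} (hu : 0 < u) {δ r a : ℝ}
    (hr : 0 < r) (ha : 0 ≤ a) (hH : BHardy Ω δ (bdryLayer Ω r) a)
    {y n : EuclideanSpace ℝ (Fin d)} (hn : ‖n‖ = 1) (hw : TouchingBalls Ω u y (u • n))
    {ψ : EuclideanSpace ℝ (Fin d) → ℝ} (hψ : ContDiff ℝ 1 ψ) (hψc : HasCompactSupport ψ)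
    (hψs : tsupport ψ ⊆ {x | 0 < ⟪n, x⟫}) :
    ∫ x, ⟪n, x⟫ ^ (δ - 2) * ψ x ^ 2 ≤ a ^ 2 * ∫ x, ⟪n, x⟫ ^ δ * (fderiv ℝ ψ x n) ^ 2 := by
  obtain ⟨c, hc, hct⟩ := hψc.isCompact.exists_forall_le' (f := fun x => ⟪n, x⟫)
    (by fun_prop) (a := 0) hψs
  obtain ⟨M, hM⟩ := hψc.isCompact.exists_bound_of_continuousOn (f := id) continuousOn_id
  set N : ℝ := M ^ 2 / (2 * u) with hN
  have hxN : ∀ x ∈ tsupport ψ, ‖x‖ ^ 2 / (2 * u) ≤ N := fun x hx => by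
    rw [hN]
    have := hM x hx
    simp only [id] at this
    gcongr
  have hDcont : Continuous (fderiv ℝ ψ) := hψ.continuous_fderiv (by norm_num)
  have hev : ∀ᶠ s : ℝ in nhdsWithin 0 (Ioi 0), 0 < s ∧ s < 1 ∧ s * N < c / 2 ∧
      s ^ 3 * (M + c) < r := by
    have t1 : Filter.Tendsto (fun s : ℝ => s * N) (nhdsWithin 0 (Ioi 0)) (nhds 0) := by
      have : Continuous fun s : ℝ => s * N := by fun_prop
      simpa using (this.tendsto 0).mono_left nhdsWithin_le_nhds
    have t2 : Filter.Tendsto (fun s : ℝ => s ^ 3 * (M + c)) (nhdsWithin 0 (Ioi 0)) (nhds 0) := by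
      have : Continuous fun s : ℝ => s ^ 3 * (M + c) := by fun_prop
      simpa using (this.tendsto 0).mono_left nhdsWithin_le_nhds
    filter_upwards [Ioo_mem_nhdsGT (zero_lt_one' ℝ), t1.eventually_lt_const (half_pos hc),
      t2.eventually_lt_const hr] with s h1 h2 h3
    exact ⟨h1.1, h1.2, h2, h3⟩
  set D : ℝ → EuclideanSpace ℝ (Fin d) → ℝ := fun s x =>
    distB Ω (y + s ^ 2 • stretch n s x) / s ^ 3 with hD
  have hDclose : ∀ᶠ s : ℝ in nhdsWithin 0 (Ioi 0), ∀ x ∈ tsupport ψ,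
      y + s ^ 2 • stretch n s x ∈ bdryLayer Ω r ∧ |D s x - ⟪n, x⟫| ≤ s * N ∧
        c / 2 ≤ D s x ∧ D s x ≤ M + c := by
    filter_upwards [hev] with s hs x hx
    obtain ⟨hs0, hs1, hs2, hs3⟩ := hs
    have hcx := hct x hx
    have hMx : ⟪n, x⟫ ≤ M := by
      have h1 := real_inner_le_norm n x
      have h2 : ‖x‖ ≤ M := hM x hx
      rw [hn, one_mul] at h1
      exact h1.trans h2
    have hsN : s * (‖x‖ ^ 2 / (2 * u)) ≤ s * N := by
      gcongr
      exact hxN x hx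
    obtain ⟨hmem, hclose⟩ := hw.distB_parabolicScaling hu hn hs0 hs1.le (x := x) (by linarith)
    have hclose' : |D s x - ⟪n, x⟫| ≤ s * N := hclose.trans hsN
    have h5 := abs_le.1 hclose'
    have h6 : D s x ≤ M + c := by linarith
    refine ⟨⟨hmem, ?_⟩, hclose', by linarith, h6⟩
    have hs3' : 0 < s ^ 3 := by positivity
    have h7 : distB Ω (y + s ^ 2 • stretch n s x) = s ^ 3 * D s x := by
      rw [hD]
      field_simp
    rw [h7]
    exact lt_of_le_of_lt (by gcongr) hs3
  have hDlim : ∀ x ∈ tsupport ψ, Filter.Tendsto (fun s => D s x) (nhdsWithin 0 (Ioi 0))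
      (nhds ⟪n, x⟫) := by
    intro x hx
    rw [tendsto_iff_norm_sub_tendsto_zero]
    refine squeeze_zero' (Filter.Eventually.of_forall fun _ => norm_nonneg _)
      (hDclose.mono fun s hs => (hs x hx).2.1) ?_
    have : Continuous fun s : ℝ => s * N := by fun_prop
    simpa using (this.tendsto 0).mono_left nhdsWithin_le_nhds
  have hDmeas : ∀ s (p : ℝ), Measurable fun x => D s x ^ p := by
    intro s p
    have h1 := continuous_distB Ω
    have h2 : Continuous (D s) := by
      simp only [hD]
      fun_prop
    exact h2.measurable.pow_const p
  set W : ℝ → ℝ := fun p => (c / 2) ^ p + (M + c) ^ p with hW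
  have hDW : ∀ᶠ s : ℝ in nhdsWithin 0 (Ioi 0), ∀ p, ∀ x ∈ tsupport ψ, |D s x ^ p| ≤ W p := by
    filter_upwards [hDclose] with s hs p x hx
    obtain ⟨-, -, h1, h2⟩ := hs x hx
    rw [abs_of_nonneg (Real.rpow_nonneg (by linarith) p)]
    exact rpow_le_rpow_add_rpow (half_pos hc) h1 h2 p
  have hψint : Integrable fun x => ψ x ^ 2 := by
    have h1 : HasCompactSupport fun x => ψ x ^ 2 := hψc.comp_left (g := fun t => t ^ 2) (by simp)
    have h2 : Continuous fun x => ψ x ^ 2 := hψ.continuous.pow 2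
    exact h2.integrable_of_hasCompactSupport h1
  have hDint : Integrable fun x => ‖fderiv ℝ ψ x‖ ^ 2 := by
    have h1 : HasCompactSupport fun x => ‖fderiv ℝ ψ x‖ ^ 2 :=
      (hψc.fderiv ℝ).comp_left (g := fun t => ‖t‖ ^ 2) (by simp)
    have h2 : Continuous fun x => ‖fderiv ℝ ψ x‖ ^ 2 := hDcont.norm.pow 2
    exact h2.integrable_of_hasCompactSupport h1
  have lim1 : Filter.Tendsto (fun s => ∫ x, D s x ^ (δ - 2) * ψ x ^ 2) (nhdsWithin 0 (Ioi 0))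
      (nhds (∫ x, ⟪n, x⟫ ^ (δ - 2) * ψ x ^ 2)) := by
    refine tendsto_integral_filter_of_dominated_convergence
      (fun x => W (δ - 2) * ψ x ^ 2)
      (Filter.Eventually.of_forall fun s => ((hDmeas s (δ - 2)).fun_mul
        (hψ.continuous.measurable.pow_const 2)).aestronglyMeasurable)
      (hDW.mono fun s hs => Filter.Eventually.of_forall fun x => ?_) ?_
      (Filter.Eventually.of_forall fun x => ?_)
    · by_cases hx : x ∈ tsupport ψ
      · rw [norm_mul, Real.norm_eq_abs, Real.norm_of_nonneg (sq_nonneg (ψ x))]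
        have := hs (δ - 2) x hx
        gcongr
      · simp [image_eq_zero_of_notMem_tsupport hx]
    · exact hψint.const_mul _
    · by_cases hx : x ∈ tsupport ψ
      · exact ((hDlim x hx).rpow_const (Or.inl (hc.trans_le (hct x hx)).ne')).mul_const _
      · simp [image_eq_zero_of_notMem_tsupport hx]
  have hDoff : ∀ x ∉ tsupport ψ, fderiv ℝ ψ x = 0 := fun x hx =>
    image_eq_zero_of_notMem_tsupport fun h => hx (tsupport_fderiv_subset ℝ h)
  have hGcont : ∀ s : ℝ, Continuous fun x =>
      ‖s • fderiv ℝ ψ x + ((1 - s) * fderiv ℝ ψ x n) • innerSL ℝ n‖ ^ 2 := fun s => by fun_prop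
  have lim2 : Filter.Tendsto (fun s => ∫ x, D s x ^ δ *
        ‖s • fderiv ℝ ψ x + ((1 - s) * fderiv ℝ ψ x n) • innerSL ℝ n‖ ^ 2) (nhdsWithin 0 (Ioi 0))
      (nhds (∫ x, ⟪n, x⟫ ^ δ * (fderiv ℝ ψ x n) ^ 2)) := by
    refine tendsto_integral_filter_of_dominated_convergence
      (fun x => W δ * ‖fderiv ℝ ψ x‖ ^ 2)
      (Filter.Eventually.of_forall fun s => ((hDmeas s δ).fun_mul
        (hGcont s).measurable).aestronglyMeasurable)
      ((hDW.and hev).mono fun s hs => Filter.Eventually.of_forall fun x => ?_) ?_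
      (Filter.Eventually.of_forall fun x => ?_)
    · by_cases hx : x ∈ tsupport ψ
      · rw [norm_mul, Real.norm_eq_abs, Real.norm_of_nonneg (sq_nonneg _)]
        have h1 := hs.1 δ x hx
        have h2 : ‖s • fderiv ℝ ψ x + ((1 - s) * fderiv ℝ ψ x n) • innerSL ℝ n‖ ≤
            ‖fderiv ℝ ψ x‖ := by
          obtain ⟨hs0, hs1, -, -⟩ := hs.2
          have h3 : ‖fderiv ℝ ψ x n‖ ≤ ‖fderiv ℝ ψ x‖ := by
            simpa [hn] using (fderiv ℝ ψ x).le_opNorm n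
          refine (norm_add_le _ _).trans ?_
          rw [norm_smul, norm_smul, norm_mul, innerSL_apply_norm, hn, Real.norm_of_nonneg hs0.le,
            Real.norm_of_nonneg (by linarith : 0 ≤ 1 - s)]
          nlinarith
        gcongr
        exact (abs_nonneg _).trans h1
      · simp [hDoff x hx]
    · exact hDint.const_mul _
    · by_cases hx : x ∈ tsupport ψ
      · refine ((hDlim x hx).rpow_const (Or.inl (hc.trans_le (hct x hx)).ne')).mul ?_
        have hcont : Continuous fun s : ℝ =>
            ‖s • fderiv ℝ ψ x + ((1 - s) * fderiv ℝ ψ x n) • innerSL ℝ n‖ ^ 2 := by fun_prop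
        have := (hcont.tendsto 0).mono_left (nhdsWithin_le_nhds (s := Ioi 0))
        convert this using 2
        rw [zero_smul, zero_add, sub_zero, one_mul, norm_smul, innerSL_apply_norm, hn, mul_one,
          Real.norm_eq_abs, sq_abs]
      · simp [hDoff x hx]
  refine le_of_tendsto_of_tendsto lim1 (lim2.const_mul (a ^ 2)) ?_
  filter_upwards [hDclose, hev] with s hs hs'
  exact hH.integral_rescaled_le hΩ ha hn y hs'.1 hψ hψc fun x hx => (hs x hx).1

end DirectionalHardy

section OneDimensional

theorem integral_Ioi_inv_mul_comp_log (H : ℝ → ℝ) :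
    ∫ t in Ioi (0 : ℝ), t⁻¹ * H (Real.log t) = ∫ s, H s := by
  have h := integral_image_eq_integral_abs_deriv_smul (s := univ) MeasurableSet.univ
    (fun x _ => (Real.hasDerivAt_exp x).hasDerivWithinAt) Real.exp_injective.injOn
    (fun t => t⁻¹ * H (Real.log t))
  rw [image_univ, Real.range_exp, setIntegral_univ] at h
  rw [h]
  congr 1
  funext x
  simp [abs_of_pos (Real.exp_pos x)]

theorem integral_sq_mul_add_deriv {G : ℝ → ℝ} (hG : ContDiff ℝ 1 G) (hGc : HasCompactSupport G)
    (β : ℝ) : ∫ s, (β * G s + deriv G s) ^ 2 = β ^ 2 * (∫ s, G s ^ 2) + ∫ s, deriv G s ^ 2 := by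
  have hG' : Continuous (deriv G) := hG.continuous_deriv le_rfl
  have hGc' : HasCompactSupport (deriv G) := hGc.deriv
  have i1 : Integrable fun s => G s ^ 2 := Continuous.integrable_of_hasCompactSupport
    (hG.continuous.pow 2) (hGc.comp_left (g := fun t => t ^ 2) (by simp))
  have i2 : Integrable fun s => deriv G s ^ 2 := Continuous.integrable_of_hasCompactSupport
    (hG'.pow 2) (hGc'.comp_left (g := fun t => t ^ 2) (by simp))
  have i3 : Integrable fun s => 2 * G s * deriv G s := Continuous.integrable_of_hasCompactSupport
    ((continuous_const.mul hG.continuous).mul hG') hGc'.mul_left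
  have h0 : ∫ s, 2 * G s * deriv G s = 0 := by
    refine integral_eq_zero_of_hasDerivAt_of_integrable (f := fun s => G s ^ 2) (fun s => ?_) i3 i1
    simpa using ((hG.differentiable one_ne_zero s).hasDerivAt.fun_pow 2)
  have e : ∀ s, (β * G s + deriv G s) ^ 2 =
      β ^ 2 * G s ^ 2 + β * (2 * G s * deriv G s) + deriv G s ^ 2 := fun s => by ring
  simp_rw [e]
  rw [integral_add ((i1.const_mul _).fun_add (i3.const_mul _)) i2,
    integral_add (i1.const_mul _) (i3.const_mul _), integral_const_mul, integral_const_mul, h0,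
    mul_zero, add_zero]

/-- The logarithmic substitution turns a weighted Hardy inequality on the half-line into an
inequality without weights on the line. -/
theorem integral_sq_le_of_hardy_Ioi {δ a : ℝ}
    (h : ∀ g : ℝ → ℝ, ContDiff ℝ 1 g → HasCompactSupport g → tsupport g ⊆ Ioi 0 →
      ∫ t, t ^ (δ - 2) * g t ^ 2 ≤ a ^ 2 * ∫ t, t ^ δ * deriv g t ^ 2)
    {G : ℝ → ℝ} (hG : ContDiff ℝ 1 G) (hGc : HasCompactSupport G) :
    ∫ s, G s ^ 2 ≤ a ^ 2 * ∫ s, ((1 - δ) / 2 * G s + deriv G s) ^ 2 := by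
  set β : ℝ := (1 - δ) / 2 with hβ
  set g : ℝ → ℝ := (Ioi 0).indicator fun t => t ^ β * G (Real.log t) with hg
  have hgpos : ∀ t, 0 < t → g t = t ^ β * G (Real.log t) := fun t ht => indicator_of_mem ht _
  have hgnonpos : ∀ t, t ≤ 0 → g t = 0 := fun t ht => indicator_of_notMem (not_lt.2 ht) _
  obtain ⟨R, hR⟩ := hGc.isCompact.isBounded.subset_closedBall 0
  have hsupp : ∀ t ∉ Icc (Real.exp (-R)) (Real.exp R), g t = 0 := by
    intro t ht
    rcases le_or_gt t 0 with h0 | h0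
    · exact hgnonpos t h0
    rw [hgpos t h0]
    refine mul_eq_zero_of_right _ (image_eq_zero_of_notMem_tsupport fun hmem => ?_)
    have := hR hmem
    rw [mem_closedBall, Real.dist_0_eq_abs, abs_le] at this
    exact ht ⟨(Real.le_log_iff_exp_le h0).1 this.1, (Real.log_le_iff_le_exp h0).1 this.2⟩
  have hts : tsupport g ⊆ Icc (Real.exp (-R)) (Real.exp R) :=
    closure_minimal (fun t ht => by_contra fun hn => ht (hsupp t hn)) isClosed_Icc
  have hgt : tsupport g ⊆ Ioi 0 := fun t ht => (Real.exp_pos _).trans_le (hts ht).1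
  have hgc : HasCompactSupport g := HasCompactSupport.intro isCompact_Icc hsupp
  have hgsm : ContDiff ℝ 1 g := by
    refine contDiff_iff_contDiffAt.2 fun t => ?_
    by_cases ht : t ∈ tsupport g
    swap
    · exact contDiffAt_const.congr_of_eventuallyEq (notMem_tsupport_iff_eventuallyEq.1 ht)
    have h0 : 0 < t := hgt ht
    have h1 : ContDiffAt ℝ 1 (fun t => t ^ β * G (Real.log t)) t :=
      (Real.contDiffAt_rpow_const_of_ne h0.ne').mul
        (hG.contDiffAt.comp t (Real.contDiffAt_log.2 h0.ne'))
    refine h1.congr_of_eventuallyEq ?_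
    filter_upwards [Ioi_mem_nhds h0] with x hx using hgpos x hx
  have hderiv : ∀ t, 0 < t → deriv g t =
      t ^ (β - 1) * (β * G (Real.log t) + deriv G (Real.log t)) := by
    intro t h0
    have h1 : HasDerivAt (fun t => t ^ β * G (Real.log t))
        (β * t ^ (β - 1) * G (Real.log t) + t ^ β * (deriv G (Real.log t) * t⁻¹)) t :=
      (Real.hasDerivAt_rpow_const (Or.inl h0.ne')).mul
        ((hG.differentiable one_ne_zero _).hasDerivAt.comp t (Real.hasDerivAt_log h0.ne'))
    have h2 : g =ᶠ[nhds t] fun t => t ^ β * G (Real.log t) := by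
      filter_upwards [Ioi_mem_nhds h0] with x hx using hgpos x hx
    rw [h2.deriv_eq, h1.deriv, Real.rpow_sub_one h0.ne']
    field_simp
  have hderiv0 : ∀ t ∉ Ioi (0 : ℝ), deriv g t = 0 := fun t ht =>
    image_eq_zero_of_notMem_tsupport fun hm => ht (hgt (tsupport_deriv_subset hm))
  have key := h g hgsm hgc hgt
  rw [← setIntegral_eq_integral_of_forall_compl_eq_zero (s := Ioi 0)
      (fun t ht => by rw [hgnonpos t (not_lt.1 ht)]; simp),
    ← setIntegral_eq_integral_of_forall_compl_eq_zero (s := Ioi 0)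
      (f := fun t => t ^ δ * deriv g t ^ 2) (fun t ht => by rw [hderiv0 t ht]; simp)] at key
  rw [← integral_Ioi_inv_mul_comp_log fun s => G s ^ 2,
    ← integral_Ioi_inv_mul_comp_log fun s => (β * G s + deriv G s) ^ 2]
  convert key using 1
  · refine setIntegral_congr_fun measurableSet_Ioi fun t (ht : 0 < t) => ?_
    rw [hgpos t ht, mul_pow, ← mul_assoc, ← Real.rpow_mul_natCast ht.le, ← Real.rpow_add ht,
      ← Real.rpow_neg_one]
    congr 2
    rw [hβ]
    push_cast
    ring
  · refine congrArg (a ^ 2 * ·) (setIntegral_congr_fun measurableSet_Ioi fun t (ht : 0 < t) => ?_)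
    rw [hderiv t ht, mul_pow, ← mul_assoc, ← Real.rpow_mul_natCast ht.le, ← Real.rpow_add ht,
      ← Real.rpow_neg_one]
    congr 2
    rw [hβ]
    push_cast
    ring

theorem exists_contDiff_hasCompactSupport_integral_sq_pos :
    ∃ χ : ℝ → ℝ, ContDiff ℝ 1 χ ∧ HasCompactSupport χ ∧ 0 < ∫ s, χ s ^ 2 := by
  let b : ContDiffBump (0 : ℝ) := default
  refine ⟨b, b.contDiff, b.hasCompactSupport, ?_⟩
  refine Continuous.integral_pos_of_hasCompactSupport_nonneg_nonzero (x := 0)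
    (b.continuous.pow 2) (b.hasCompactSupport.comp_left (g := fun t => t ^ 2) (by simp))
    (fun x => sq_nonneg _) ?_
  simp [b.one_of_mem_closedBall (mem_closedBall_self b.rIn_pos.le)]

/-- The constant in the weighted Hardy inequality on the half-line is at least `2 / |δ - 1|`. -/
theorem two_div_le_of_hardy_Ioi {δ a : ℝ} (ha : 0 ≤ a) (hδ : δ ≠ 1)
    (h : ∀ g : ℝ → ℝ, ContDiff ℝ 1 g → HasCompactSupport g → tsupport g ⊆ Ioi 0 →
      ∫ t, t ^ (δ - 2) * g t ^ 2 ≤ a ^ 2 * ∫ t, t ^ δ * deriv g t ^ 2) :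
    2 / |δ - 1| ≤ a := by
  obtain ⟨χ, hχ, hχc, hpos⟩ := exists_contDiff_hasCompactSupport_integral_sq_pos
  have hε : ∀ ε : ℝ, 0 < ε → ∫ s, χ s ^ 2 ≤
      a ^ 2 * (((1 - δ) / 2) ^ 2 * (∫ s, χ s ^ 2) + ε ^ 2 * ∫ s, deriv χ s ^ 2) := by
    intro ε hε
    have hG : ContDiff ℝ 1 fun s => χ (ε * s) := by fun_prop
    have hGc : HasCompactSupport fun s => χ (ε * s) :=
      hχc.comp_homeomorph (Homeomorph.mulLeft₀ ε hε.ne')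
    have key := integral_sq_le_of_hardy_Ioi h hG hGc
    rw [integral_sq_mul_add_deriv hG hGc] at key
    have hd : ∀ s, deriv (fun s => χ (ε * s)) s = ε * deriv χ (ε * s) := fun s =>
      deriv_comp_mul_left ε χ s
    simp_rw [hd, mul_pow] at key
    rw [integral_const_mul, Measure.integral_comp_mul_left (fun s => χ s ^ 2),
      Measure.integral_comp_mul_left (fun s => deriv χ s ^ 2), abs_of_pos (inv_pos.2 hε),
      smul_eq_mul, smul_eq_mul] at key
    refine le_of_mul_le_mul_left (key.trans_eq ?_) (inv_pos.2 hε)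
    ring
  have hlim : ∫ s, χ s ^ 2 ≤ a ^ 2 * (((1 - δ) / 2) ^ 2 * ∫ s, χ s ^ 2) := by
    have hcont : Continuous fun ε : ℝ =>
        a ^ 2 * (((1 - δ) / 2) ^ 2 * (∫ s, χ s ^ 2) + ε ^ 2 * ∫ s, deriv χ s ^ 2) := by fun_prop
    have := (hcont.tendsto 0).mono_left (nhdsWithin_le_nhds (s := Ioi 0))
    refine (ge_of_tendsto this (eventually_mem_nhdsWithin.mono hε)).trans_eq ?_
    ring
  have h1 : 1 ≤ a ^ 2 * ((1 - δ) / 2) ^ 2 := by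
    rw [← mul_assoc] at hlim
    exact one_le_of_le_mul_right₀ hpos hlim
  have hd : 0 < |δ - 1| := abs_pos.2 (sub_ne_zero.2 hδ)
  rw [div_le_iff₀ hd]
  refine le_of_sq_le_sq ?_ (by positivity)
  rw [mul_pow, sq_abs]
  linarith

end OneDimensional

section ProductTestFunction

variable {d : ℕ}

theorem OrthonormalBasis.integral_mul_prod_inner
    (b : OrthonormalBasis (Fin d) ℝ (EuclideanSpace ℝ (Fin d))) (i₀ : Fin d) (p q : ℝ → ℝ) :
    ∫ x, p ⟪b i₀, x⟫ * ∏ i ∈ Finset.univ.erase i₀, q ⟪b i, x⟫ =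
      (∫ t, p t) * (∫ t, q t) ^ (d - 1) := by
  set h : Fin d → ℝ → ℝ := Function.update (fun _ => q) i₀ p with hh
  have h1 : ∀ x : EuclideanSpace ℝ (Fin d), p ⟪b i₀, x⟫ *
      ∏ i ∈ Finset.univ.erase i₀, q ⟪b i, x⟫ =
        (fun z : Fin d → ℝ => ∏ i, h i (z i)) (WithLp.ofLp (b.repr x)) := by
    intro x
    simp only [OrthonormalBasis.repr_apply_apply]
    rw [← Finset.mul_prod_erase _ _ (Finset.mem_univ i₀), hh, Function.update_self]
    congr 1
    refine Finset.prod_congr rfl fun i hi => ?_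
    rw [Function.update_of_ne (Finset.ne_of_mem_erase hi)]
  have hmp : MeasurePreserving (fun x => WithLp.ofLp (b.repr x)) volume volume :=
    (PiLp.volume_preserving_ofLp (Fin d)).comp b.measurePreserving_repr
  have hemb : MeasurableEmbedding fun x => WithLp.ofLp (b.repr x) :=
    (b.repr.toHomeomorph.trans (EuclideanSpace.equiv (Fin d) ℝ).toHomeomorph).measurableEmbedding
  simp_rw [h1]
  rw [hmp.integral_comp hemb fun z : Fin d → ℝ => ∏ i, h i (z i),
    integral_fintype_prod_volume_eq_prod, ← Finset.mul_prod_erase _ _ (Finset.mem_univ i₀), hh,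
    Function.update_self]
  congr 1
  rw [Finset.prod_congr rfl fun i hi => by
    rw [Function.update_of_ne (Finset.ne_of_mem_erase hi)]]
  simp

theorem exists_orthonormalBasis_apply_eq (hd : 1 ≤ d) {n : EuclideanSpace ℝ (Fin d)}
    (hn : ‖n‖ = 1) :
    ∃ (b : OrthonormalBasis (Fin d) ℝ (EuclideanSpace ℝ (Fin d))) (i₀ : Fin d), b i₀ = n := by
  have i₀ : Fin d := ⟨0, hd⟩
  have ho : Orthonormal ℝ (({i₀} : Set (Fin d)).domRestrict fun _ => n) := by
    refine ⟨fun _ => hn, fun i j hij => (hij (Subsingleton.elim i j)).elim⟩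
  obtain ⟨b, hb⟩ := ho.exists_orthonormalBasis_extension_of_card_eq (by simp)
  exact ⟨b, i₀, hb i₀ rfl⟩

/-- A Hardy inequality on a half-space for the normal derivative implies the one on the
half-line, by testing it on products. -/
theorem hardy_Ioi_of_halfSpace (hd : 1 ≤ d) {δ a : ℝ} {n : EuclideanSpace ℝ (Fin d)}
    (hn : ‖n‖ = 1)
    (h : ∀ ψ : EuclideanSpace ℝ (Fin d) → ℝ, ContDiff ℝ 1 ψ → HasCompactSupport ψ →
      tsupport ψ ⊆ {x | 0 < ⟪n, x⟫} →
      ∫ x, ⟪n, x⟫ ^ (δ - 2) * ψ x ^ 2 ≤ a ^ 2 * ∫ x, ⟪n, x⟫ ^ δ * (fderiv ℝ ψ x n) ^ 2)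
    {g : ℝ → ℝ} (hg : ContDiff ℝ 1 g) (hgc : HasCompactSupport g) (hgs : tsupport g ⊆ Ioi 0) :
    ∫ t, t ^ (δ - 2) * g t ^ 2 ≤ a ^ 2 * ∫ t, t ^ δ * deriv g t ^ 2 := by
  obtain ⟨b, i₀, rfl⟩ := exists_orthonormalBasis_apply_eq hd hn
  obtain ⟨χ, hχ, hχc, hpos⟩ := exists_contDiff_hasCompactSupport_integral_sq_pos
  set ψ : EuclideanSpace ℝ (Fin d) → ℝ := fun x =>
    g ⟪b i₀, x⟫ * ∏ i ∈ Finset.univ.erase i₀, χ ⟪b i, x⟫ with hψ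
  have hψdiff : ContDiff ℝ 1 ψ := by
    have h1 : ∀ i, ContDiff ℝ 1 fun x : EuclideanSpace ℝ (Fin d) => ⟪b i, x⟫ := fun i =>
      contDiff_const.inner ℝ contDiff_id
    exact (hg.comp (h1 i₀)).mul (contDiff_prod fun i _ => hχ.comp (h1 i))
  set T := b.repr.toHomeomorph.trans (EuclideanSpace.equiv (Fin d) ℝ).toHomeomorph with hT
  have hTx : ∀ x i, T x i = ⟪b i, x⟫ := fun x i => b.repr_apply_apply x i
  set K : Set (EuclideanSpace ℝ (Fin d)) := T ⁻¹' univ.pi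
    (Function.update (fun _ => tsupport χ) i₀ (tsupport g)) with hK
  have hKc : IsCompact K := by
    refine T.isCompact_preimage.2 (isCompact_univ_pi fun i => ?_)
    rcases eq_or_ne i i₀ with rfl | hi
    · rw [Function.update_self]
      exact hgc
    · rw [Function.update_of_ne hi]
      exact hχc
  have hψK : ∀ x ∉ K, ψ x = 0 := by
    intro x hx
    by_contra h0
    refine hx fun i _ => ?_
    rw [hTx]
    rcases eq_or_ne i i₀ with rfl | hi
    · rw [Function.update_self]
      exact subset_tsupport g (left_ne_zero_of_mul h0)
    · rw [Function.update_of_ne hi]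
      exact subset_tsupport χ (Finset.prod_ne_zero_iff.1 (right_ne_zero_of_mul h0) i
        (Finset.mem_erase.2 ⟨hi, Finset.mem_univ i⟩))
  have hψs : tsupport ψ ⊆ {x | 0 < ⟪b i₀, x⟫} := by
    have h1 : tsupport ψ ⊆ K :=
      closure_minimal (fun x hx => by_contra fun hn => hx (hψK x hn)) hKc.isClosed
    intro x hx
    have h2 := h1 hx i₀ (mem_univ _)
    rw [hTx, Function.update_self] at h2
    exact hgs h2
  have hderiv : ∀ x, fderiv ℝ ψ x (b i₀) =
      deriv g ⟪b i₀, x⟫ * ∏ i ∈ Finset.univ.erase i₀, χ ⟪b i, x⟫ := by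
    intro x
    rw [← (hψdiff.differentiable one_ne_zero x).lineDeriv_eq_fderiv, lineDeriv]
    have h1 : (fun t : ℝ => ψ (x + t • b i₀)) = fun t =>
        g (⟪b i₀, x⟫ + t) * ∏ i ∈ Finset.univ.erase i₀, χ ⟪b i, x⟫ := by
      funext t
      simp only [hψ, inner_add_right, inner_smul_right, b.inner_eq_one, mul_one]
      congr 1
      refine Finset.prod_congr rfl fun i hi => ?_
      rw [b.inner_eq_zero (Finset.ne_of_mem_erase hi), mul_zero, add_zero]
    rw [h1, deriv_mul_const_field, deriv_comp_const_add, add_zero]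
  have key := h ψ hψdiff (HasCompactSupport.intro hKc hψK) hψs
  simp_rw [hderiv, hψ, mul_pow, ← Finset.prod_pow, ← mul_assoc] at key
  rw [b.integral_mul_prod_inner i₀ (fun t => t ^ (δ - 2) * g t ^ 2) fun t => χ t ^ 2,
    b.integral_mul_prod_inner i₀ (fun t => t ^ δ * deriv g t ^ 2) fun t => χ t ^ 2,
    ← mul_assoc] at key
  exact le_of_mul_le_mul_right key (pow_pos hpos _)

end ProductTestFunction

theorem BHardy.two_div_le {d : ℕ} {Ω : Set (EuclideanSpace ℝ (Fin d))} (hd : 1 ≤ d)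
    (hΩ : IsDomainSet Ω) {u : ℝ} (hu : 0 < u) (hball : ∀ y ∈ frontier Ω, TwoSidedBall Ω u y)
    {δ r a : ℝ} (hδ : δ ≠ 1) (hr : 0 < r) (ha : 0 ≤ a) (hH : BHardy Ω δ (bdryLayer Ω r) a) :
    2 / |δ - 1| ≤ a := by
  obtain ⟨y, hy⟩ := hΩ.frontier_nonempty
  obtain ⟨w, hw⟩ := (hball y hy).exists_touchingBalls hΩ hu hy
  have hn : ‖u⁻¹ • w‖ = 1 := by
    rw [norm_smul, hw.norm_eq, norm_inv, Real.norm_of_nonneg hu.le, inv_mul_cancel₀ hu.ne']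
  have hw' : TouchingBalls Ω u y (u • u⁻¹ • w) := by rwa [smul_inv_smul₀ hu.ne']
  exact two_div_le_of_hardy_Ioi ha hδ fun g hg hgc hgs =>
    hardy_Ioi_of_halfSpace hd hn (fun ψ hψ hψc hψs =>
      hH.integral_halfSpace_le hΩ hu hr ha hn hw' hψ hψc hψs) hg hgc hgs

/-- If `Ω` is a `C^{1,1}`-domain (i.e. the two-sided ball condition with
some radius `u > 0` holds at every boundary point) and `δ ≥ 0`, `δ ≠ 1`, then for all
sufficiently small `r > 0` the boundary Hardy inequality holds on `Γ_r` with some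
constant `a > 0`, and the boundary Hardy constant is `a_δ(Γ) = 2/|δ-1|`. -/
theorem stmt11 {d : ℕ} (hd : 1 ≤ d) (Ω : Set (EuclideanSpace ℝ (Fin d)))
    (hΩ : IsDomainSet Ω)
    (u : ℝ) (hu : 0 < u) (hball : ∀ y ∈ frontier Ω, TwoSidedBall Ω u y)
    (δ : ℝ) (hδ0 : 0 ≤ δ) (hδ1 : δ ≠ 1) :
    (∃ r₀ > (0:ℝ), ∀ r ∈ Set.Ioo (0:ℝ) r₀, ∃ a > (0:ℝ), BHardy Ω δ (bdryLayer Ω r) a) ∧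
    hardyConst Ω δ = ENNReal.ofReal (2 / |δ - 1|) := by
  have hd0 : (0 : ℝ) < d := by exact_mod_cast hd
  have hδ : 0 < |δ - 1| := abs_pos.2 (sub_ne_zero.2 hδ1)
  set r₀ : ℝ := min (u / 2) (|δ - 1| * u / (2 * d)) with hr₀
  have hr₀pos : 0 < r₀ := lt_min (by positivity) (by positivity)
  have hκ : ∀ r < r₀, 0 < |δ - 1| - 2 * d / u * r := by
    intro r hr
    have h1 : r < |δ - 1| * u / (2 * d) := hr.trans_le (min_le_right _ _)
    rw [lt_div_iff₀ (by positivity)] at h1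
    rw [sub_pos, div_mul_eq_mul_div, div_lt_iff₀ hu]
    linarith
  have hB : ∀ r ∈ Ioo (0 : ℝ) r₀,
      BHardy Ω δ (bdryLayer Ω r) (2 / (|δ - 1| - 2 * d / u * r)) := fun r hr =>
    bHardy_bdryLayer hΩ hu hball δ (hr.2.le.trans (min_le_left _ _)) (hκ r hr.2)
  refine ⟨⟨r₀, hr₀pos, fun r hr => ⟨_, div_pos two_pos (hκ r hr.2), hB r hr⟩⟩, le_antisymm ?_ ?_⟩
  · have hlim : Filter.Tendsto (fun r : ℝ => ENNReal.ofReal (2 / (|δ - 1| - 2 * d / u * r)))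
        (nhdsWithin 0 (Ioi 0)) (nhds (ENNReal.ofReal (2 / |δ - 1|))) := by
      have hc : ContinuousAt (fun r : ℝ => 2 / (|δ - 1| - 2 * d / u * r)) 0 :=
        ContinuousAt.div (by fun_prop) (by fun_prop) (by simpa using hδ.ne')
      have := (ENNReal.tendsto_ofReal hc.tendsto).mono_left (nhdsWithin_le_nhds (s := Ioi 0))
      simpa using this
    refine ge_of_tendsto hlim ?_
    filter_upwards [Ioo_mem_nhdsGT hr₀pos] with r hr
    exact (iInf₂_le r hr.1).trans (sInf_le ⟨_, div_pos two_pos (hκ r hr.2), rfl, hB r hr⟩)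
  · refine le_iInf₂ fun r hr => le_sInf ?_
    rintro _ ⟨a, ha, rfl, hH⟩
    exact ENNReal.ofReal_le_ofReal (hH.two_div_le hd hΩ hu hball hδ1 hr ha.le)
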